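/- arXiv:2401.17532 — 2 statements merged into one kernel-verified Lean document; each statement's English description precedes it below -/
import Mathlib

section
/- Let σ be the arc-length measure on the unit circle S¹ ⊂ ℝ², and for θ ∈ ℝ let R_θ denote rotation of ℝ² by angle θ. For nonnegative measurable g,h : ℝ² → [0,∞) define B_θ(g,h)(x) = ∫_{S¹} g(x−y) h(x−R_θ y) dσ(y), and define the trilinear form Λ(f,g,h) = ∫_{ℝ²} f(x) (B_{π/3}(g,h)(x) + B_{−π/3}(g,h)(x)) dx, which is the form Λ_G attached to the complete graph G on three vertices with unit-circle kernel. Let P be the convex hull of the seven points (1,0,0), (0,1,0), (0,0,1), (2/3,2/3,0), (2/3,0,2/3), (0,2/3,2/3), (1/2,1/2,1/2) in ℝ³. Then: (i) for every (a₁,a₂,a₃) ∈ P with (a₁,a₂,a₃) ≠ (1/2,1/2,1/2) there exists C > 0 such that Λ(f,g,h) ≤ C ‖f‖_{L^{1/a₁}(ℝ²)} ‖g‖_{L^{1/a₂}(ℝ²)} ‖h‖_{L^{1/a₃}(ℝ²)} for all nonnegative measurable f,g,h (with L^{1/0} = L^∞); and (ii) a restricted strong type estimate holds at (1/2,1/2,1/2):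 there exists C > 0 such that Λ(1_{E₁}, 1_{E₂}, 1_{E₃}) ≤ C (|E₁| |E₂| |E₃|)^{1/2} for all measurable sets E₁,E₂,E₃ ⊂ ℝ² of finite Lebesgue measure. -/
open MeasureTheory ENNReal NNReal Real

noncomputable section

/-- The arc-length measure on the unit circle `S¹ ⊂ ℝ²`: the one-dimensional Hausdorff
measure restricted to the unit circle. -/
def circleMeasure : Measure (EuclideanSpace ℝ (Fin 2)) :=
  (MeasureTheory.Measure.hausdorffMeasure 1).restrict
    (Metric.sphere (0 : EuclideanSpace ℝ (Fin 2)) 1)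

/-- Rotation of `ℝ²` by the angle `θ` about the origin. -/
def rot (θ : ℝ) (y : EuclideanSpace ℝ (Fin 2)) : EuclideanSpace ℝ (Fin 2) :=
  (WithLp.equiv 2 (Fin 2 → ℝ)).symm
    ![Real.cos θ * y 0 - Real.sin θ * y 1, Real.sin θ * y 0 + Real.cos θ * y 1]

/-- The bilinear generalized Radon transform
`B_θ(g,h)(x) = ∫_{S¹} g(x−y) h(x−R_θ y) dσ(y)`. -/
def Brot (θ : ℝ) (g h : EuclideanSpace ℝ (Fin 2) → ℝ≥0)
    (x : EuclideanSpace ℝ (Fin 2)) : ℝ≥0∞ :=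
  ∫⁻ y, (g (x - y) : ℝ≥0∞) * (h (x - rot θ y) : ℝ≥0∞) ∂circleMeasure

/-- The trilinear form attached to the complete graph on three vertices with the
unit-circle kernel: `Λ(f,g,h) = ∫ f(x) (B_{π/3}(g,h)(x) + B_{−π/3}(g,h)(x)) dx`. -/
def triangleForm (f g h : EuclideanSpace ℝ (Fin 2) → ℝ≥0) : ℝ≥0∞ :=
  ∫⁻ x, (f x : ℝ≥0∞) * (Brot (π/3) g h x + Brot (-(π/3)) g h x)

/-- The `L^p` norm (`p ∈ [1,∞]`) of a nonnegative function on `ℝ^d`. -/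
def nnLpNorm' {d : ℕ} (p : ℝ≥0∞) (f : EuclideanSpace ℝ (Fin d) → ℝ≥0) : ℝ≥0∞ :=
  eLpNorm (fun x => (f x : ℝ)) p volume

/-- The point of the unit circle at angle `s`. -/
def circlePoint (s : ℝ) : EuclideanSpace ℝ (Fin 2) := !₂[Real.cos s, Real.sin s]

@[fun_prop]
lemma continuous_circlePoint : Continuous circlePoint := by
  unfold circlePoint
  fun_prop

@[fun_prop]
lemma measurable_circlePoint : Measurable circlePoint := continuous_circlePoint.measurable

lemma rot_circlePoint (θ s : ℝ) : rot θ (circlePoint s) = circlePoint (s + θ) := by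
  ext i
  fin_cases i <;> simp [rot, circlePoint, Real.cos_add, Real.sin_add] <;> ring

@[fun_prop]
lemma measurable_rot (θ : ℝ) : Measurable (rot θ) := by
  have : Continuous (rot θ) := by
    unfold rot
    simp only [WithLp.equiv_symm_apply]
    refine (PiLp.continuous_toLp 2 _).comp (continuous_pi fun i => ?_)
    fin_cases i <;> simp <;> fun_prop
  exact this.measurable

lemma lipschitzWith_circlePoint : LipschitzWith 1 circlePoint := by
  refine LipschitzWith.of_dist_le_mul fun s t => ?_
  rw [NNReal.coe_one, one_mul, EuclideanSpace.dist_eq, Fin.sum_univ_two, Real.dist_eq,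
    Real.dist_eq, Real.dist_eq]
  refine Real.sqrt_le_iff.2 ⟨abs_nonneg _, ?_⟩
  rw [sq_abs, sq_abs, sq_abs]
  simp only [circlePoint, PiLp.toLp_apply, Matrix.cons_val_zero, Matrix.cons_val_one]
  have h := Real.one_sub_sq_div_two_le_cos (x := s - t)
  rw [Real.cos_sub] at h
  nlinarith [Real.sin_sq_add_cos_sq s, Real.sin_sq_add_cos_sq t]

lemma exists_circlePoint_eq {y : EuclideanSpace ℝ (Fin 2)} (hy : y ∈ Metric.sphere 0 1) :
    ∃ s ∈ Set.Ico 0 (2 * π), circlePoint s = y := by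
  have h1 : (y 0) ^ 2 + (y 1) ^ 2 = 1 := by
    have := EuclideanSpace.norm_sq_eq y
    rw [mem_sphere_zero_iff_norm.1 hy, Fin.sum_univ_two] at this
    simp only [Real.norm_eq_abs, sq_abs] at this
    linarith
  set z : ℂ := ⟨y 0, y 1⟩ with hz
  have hn : ‖z‖ = 1 := by
    rw [Complex.norm_eq_sqrt_sq_add_sq, h1, Real.sqrt_one]
  have hz0 : z ≠ 0 := by
    intro h
    simp [h] at hn
  refine ⟨toIcoMod Real.two_pi_pos 0 (Complex.arg z), ?_, ?_⟩
  · simpa using toIcoMod_mem_Ico Real.two_pi_pos 0 (Complex.arg z)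
  · have hs : toIcoMod Real.two_pi_pos 0 (Complex.arg z)
        = Complex.arg z - toIcoDiv Real.two_pi_pos 0 (Complex.arg z) * (2 * π) := by
      rw [toIcoMod, zsmul_eq_mul]
    ext i
    fin_cases i
    · change Real.cos _ = z.re
      rw [hs, Real.cos_sub_int_mul_two_pi, Complex.cos_arg hz0, hn, div_one]
    · change Real.sin _ = z.im
      rw [hs, Real.sin_sub_int_mul_two_pi, Complex.sin_arg, hn, div_one]

lemma circleMeasure_le :
    circleMeasure ≤ (volume.restrict (Set.Ico 0 (2 * π))).map circlePoint := by
  refine Measure.le_iff.2 fun A hA => ?_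
  rw [circleMeasure, Measure.restrict_apply hA,
    Measure.map_apply measurable_circlePoint hA,
    Measure.restrict_apply (measurable_circlePoint hA), ← MeasureTheory.hausdorffMeasure_real]
  have hsub : A ∩ Metric.sphere 0 1
      ⊆ circlePoint '' (circlePoint ⁻¹' A ∩ Set.Ico 0 (2 * π)) := by
    rintro y ⟨hyA, hy⟩
    obtain ⟨s, hs, rfl⟩ := exists_circlePoint_eq hy
    exact ⟨s, ⟨hyA, hs⟩, rfl⟩
  refine (measure_mono hsub).trans ?_
  simpa using lipschitzWith_circlePoint.hausdorffMeasure_image_le zero_le_one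
    (circlePoint ⁻¹' A ∩ Set.Ico 0 (2 * π))

/-- The change of variables `(s, t) ↦ e(s + β) - e(t + γ)`, whose Jacobian is
`sin ((s + β) - (t + γ))`. -/
lemma lintegral_circlePoint_sub_le {β γ A : ℝ} {D : Set (ℝ × ℝ)} (hD : MeasurableSet D)
    (hpos : ∀ p ∈ D, 0 < (p.1 + β) - (p.2 + γ)) (hlt : ∀ p ∈ D, (p.1 + β) - (p.2 + γ) < π)
    (hA : ∀ p ∈ D, A ≤ p.1 + p.2) (hA' : ∀ p ∈ D, p.1 + p.2 < A + 4 * π)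
    (G : EuclideanSpace ℝ (Fin 2) → ℝ≥0∞) :
    ∫⁻ p in D, ENNReal.ofReal (Real.sin ((p.1 + β) - (p.2 + γ))) *
      G (circlePoint (p.1 + β) - circlePoint (p.2 + γ)) ≤ ∫⁻ x, G x := by
  set ψ : EuclideanSpace ℝ (Fin 2) ≃ᵐ ℝ × ℝ :=
    (MeasurableEquiv.toLp 2 (Fin 2 → ℝ)).symm.trans MeasurableEquiv.finTwoArrow with hψ
  have hψm : MeasurePreserving ψ volume volume :=
    (EuclideanSpace.volume_preserving_symm_measurableEquiv_toLp (Fin 2)).trans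
      (volume_preserving_finTwoArrow ℝ)
  set Φ : ℝ × ℝ → ℝ × ℝ := fun p =>
    (Real.cos (p.1 + β) - Real.cos (p.2 + γ), Real.sin (p.1 + β) - Real.sin (p.2 + γ)) with hΦ
  have hψΦ : ∀ p, ψ.symm (Φ p) = circlePoint (p.1 + β) - circlePoint (p.2 + γ) := by
    intro p
    rw [MeasurableEquiv.symm_apply_eq]
    rfl
  set Φ' : ℝ × ℝ → (ℝ × ℝ →L[ℝ] ℝ × ℝ) := fun p =>
    (Matrix.toLin (.finTwoProd ℝ) (.finTwoProd ℝ)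
      !![-Real.sin (p.1 + β), Real.sin (p.2 + γ);
        Real.cos (p.1 + β), -Real.cos (p.2 + γ)]).toContinuousLinearMap with hΦ'
  have hderiv : ∀ p ∈ D, HasFDerivWithinAt Φ (Φ' p) D p := by
    intro p _
    refine HasFDerivAt.hasFDerivWithinAt ?_
    simp only [hΦ', Matrix.toLin_finTwoProd_toContinuousLinearMap]
    have h1 : HasFDerivAt (fun q : ℝ × ℝ => q.1 + β) (ContinuousLinearMap.fst ℝ ℝ ℝ) p :=
      hasFDerivAt_fst.add_const β
    have h2 : HasFDerivAt (fun q : ℝ × ℝ => q.2 + γ) (ContinuousLinearMap.snd ℝ ℝ ℝ) p :=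
      hasFDerivAt_snd.add_const γ
    refine (HasFDerivAt.prodMk (𝕜 := ℝ) (h1.cos.sub h2.cos) (h1.sin.sub h2.sin)).congr_fderiv ?_
    ext <;> simp
  have hdet : ∀ p, (Φ' p).det = Real.sin ((p.1 + β) - (p.2 + γ)) := by
    intro p
    simp only [hΦ', LinearMap.det_toContinuousLinearMap, LinearMap.det_toLin,
      Matrix.det_fin_two_of, Real.sin_sub]
    ring
  have hinj : Set.InjOn Φ D := by
    intro p hp q hq hpq
    have e1 : Real.cos (p.1 + β) - Real.cos (p.2 + γ)
        = Real.cos (q.1 + β) - Real.cos (q.2 + γ) := congrArg Prod.fst hpq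
    have e2 : Real.sin (p.1 + β) - Real.sin (p.2 + γ)
        = Real.sin (q.1 + β) - Real.sin (q.2 + γ) := congrArg Prod.snd hpq
    rw [Real.cos_sub_cos, Real.cos_sub_cos] at e1
    rw [Real.sin_sub_sin, Real.sin_sub_sin] at e2
    have p1 := hpos p hp
    have p2 := hlt p hp
    have q1 := hpos q hq
    have q2 := hlt q hq
    have a1 := hA p hp
    have a2 := hA' p hp
    have b1 := hA q hq
    have b2 := hA' q hq
    set d := ((p.1 + β) - (p.2 + γ)) / 2 with hd
    set d' := ((q.1 + β) - (q.2 + γ)) / 2 with hd'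
    set m := ((p.1 + β) + (p.2 + γ)) / 2 with hm
    set m' := ((q.1 + β) + (q.2 + γ)) / 2 with hm'
    have sd : 0 < Real.sin d := Real.sin_pos_of_pos_of_lt_pi (by linarith) (by linarith)
    have sd' : 0 < Real.sin d' := Real.sin_pos_of_pos_of_lt_pi (by linarith) (by linarith)
    have hsq : Real.sin d ^ 2 = Real.sin d' ^ 2 := by
      have t1 : (Real.sin m * Real.sin d) ^ 2 = (Real.sin m' * Real.sin d') ^ 2 := by
        congr 1; linarith
      have t2 : (Real.sin d * Real.cos m) ^ 2 = (Real.sin d' * Real.cos m') ^ 2 := by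
        congr 1; linarith
      have u1 := Real.sin_sq_add_cos_sq m
      have u2 := Real.sin_sq_add_cos_sq m'
      calc Real.sin d ^ 2 = (Real.sin m * Real.sin d) ^ 2 + (Real.sin d * Real.cos m) ^ 2 := by
            linear_combination (-(Real.sin d) ^ 2) * u1
        _ = (Real.sin m' * Real.sin d') ^ 2 + (Real.sin d' * Real.cos m') ^ 2 := by rw [t1, t2]
        _ = Real.sin d' ^ 2 := by linear_combination ((Real.sin d') ^ 2) * u2
    have hsd : Real.sin d = Real.sin d' := by
      rwa [sq_eq_sq₀ sd.le sd'.le] at hsq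
    have hdd : d = d' := Real.injOn_sin ⟨by linarith, by linarith⟩ ⟨by linarith, by linarith⟩ hsd
    rw [← hsd] at e1 e2
    have hs : Real.sin m = Real.sin m' := mul_right_cancel₀ sd.ne' (by linarith)
    have hc : Real.cos m = Real.cos m' := mul_left_cancel₀ sd.ne' (by linarith)
    have hmm : m - m' = 0 := by
      refine (Real.cos_eq_one_iff_of_lt_of_lt (by linarith) (by linarith)).1 ?_
      rw [Real.cos_sub, hs, hc]
      linarith [Real.sin_sq_add_cos_sq m']
    ext <;> linarith
  have key := lintegral_image_eq_lintegral_abs_det_fderiv_mul volume hD hderiv hinj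
    (fun z => G (ψ.symm z))
  have hL : ∫⁻ p in D, ENNReal.ofReal (Real.sin ((p.1 + β) - (p.2 + γ))) *
      G (circlePoint (p.1 + β) - circlePoint (p.2 + γ))
      = ∫⁻ p in D, ENNReal.ofReal |(Φ' p).det| * G (ψ.symm (Φ p)) := by
    refine setLIntegral_congr_fun hD fun p hp => ?_
    rw [hψΦ, hdet, abs_of_pos (Real.sin_pos_of_pos_of_lt_pi (hpos p hp) (hlt p hp))]
  rw [hL, ← key]
  refine (setLIntegral_le_lintegral _ _).trans ?_
  rw [← hψm.lintegral_comp_emb ψ.measurableEmbedding]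
  simp only [MeasurableEquiv.symm_apply_apply, le_refl]

lemma lintegral_comp_abs_eq {φ : ℝ → ℝ≥0∞} :
    ∫⁻ y : ℝ, φ |y| = 2 * ∫⁻ y in Set.Ioi (0 : ℝ), φ y := by
  have h1 : ∫⁻ y in Set.Ioi (0 : ℝ), φ |y| = ∫⁻ y in Set.Ioi (0 : ℝ), φ y :=
    setLIntegral_congr_fun measurableSet_Ioi fun y hy => by rw [abs_of_pos hy]
  have h2 : ∫⁻ y in Set.Iio (0 : ℝ), φ |y| = ∫⁻ y in Set.Ioi (0 : ℝ), φ |y| := by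
    have := (Measure.measurePreserving_neg (volume : Measure ℝ)).setLIntegral_comp_preimage_emb
      (MeasurableEquiv.neg ℝ).measurableEmbedding (fun y => φ |y|) (Set.Ioi 0)
    rw [← this]
    simp [abs_neg]
  rw [← lintegral_add_compl _ (measurableSet_Ioi (a := (0 : ℝ))), Set.compl_Ioi,
    setLIntegral_congr (Iio_ae_eq_Iic (a := (0 : ℝ))).symm, h2, h1, two_mul]

lemma lintegral_singular_kernel_le {ρ : ℝ} (hρ : 0 < ρ) :
    ∫⁻ y in Set.Ioi (0 : ℝ), ENNReal.ofReal
      (if y ≤ ρ then y ^ (-(3 / 4) : ℝ) * ρ ^ (-(3 / 4) : ℝ) else y ^ (-(3 / 2) : ℝ))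
      ≤ ENNReal.ofReal (6 * ρ ^ (-(1 / 2) : ℝ)) := by
  rw [← Set.Ioc_union_Ioi_eq_Ioi hρ.le,
    lintegral_union measurableSet_Ioi (Set.Ioc_disjoint_Ioi le_rfl)]
  have h1 : ∫⁻ y in Set.Ioc 0 ρ, ENNReal.ofReal
      (if y ≤ ρ then y ^ (-(3 / 4) : ℝ) * ρ ^ (-(3 / 4) : ℝ) else y ^ (-(3 / 2) : ℝ))
      = ENNReal.ofReal (4 * ρ ^ (-(1 / 2) : ℝ)) := by
    rw [setLIntegral_congr_fun measurableSet_Ioc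
      (g := fun y => ENNReal.ofReal (y ^ (-(3 / 4) : ℝ) * ρ ^ (-(3 / 4) : ℝ)))
      fun y hy => by rw [if_pos hy.2]]
    have hint : IntervalIntegrable (fun y : ℝ => y ^ (-(3 / 4) : ℝ)) volume 0 ρ :=
      intervalIntegral.intervalIntegrable_rpow' (by norm_num)
    rw [← ofReal_integral_eq_lintegral_ofReal]
    · rw [← intervalIntegral.integral_of_le hρ.le, intervalIntegral.integral_mul_const,
        integral_rpow (Or.inl (by norm_num)), Real.zero_rpow (by norm_num)]
      congr 1
      have : ρ ^ (-(1 / 2) : ℝ) = ρ ^ (-(3 / 4) + 1 : ℝ) * ρ ^ (-(3 / 4) : ℝ) := by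
        rw [← Real.rpow_add hρ]; norm_num
      rw [this]
      ring
    · exact ((intervalIntegrable_iff_integrableOn_Ioc_of_le hρ.le).1 hint).mul_const _
    · filter_upwards [ae_restrict_mem measurableSet_Ioc] with y hy
      have := hy.1
      positivity
  have h2 : ∫⁻ y in Set.Ioi ρ, ENNReal.ofReal
      (if y ≤ ρ then y ^ (-(3 / 4) : ℝ) * ρ ^ (-(3 / 4) : ℝ) else y ^ (-(3 / 2) : ℝ))
      = ENNReal.ofReal (2 * ρ ^ (-(1 / 2) : ℝ)) := by
    rw [setLIntegral_congr_fun measurableSet_Ioi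
      (g := fun y => ENNReal.ofReal (y ^ (-(3 / 2) : ℝ)))
      fun y hy => by rw [if_neg (not_le.2 hy)]]
    rw [← ofReal_integral_eq_lintegral_ofReal]
    · rw [integral_Ioi_rpow_of_lt (by norm_num) hρ]
      congr 1
      rw [show (-(3 / 2) + 1 : ℝ) = -(1 / 2) by norm_num]
      ring
    · exact integrableOn_Ioi_rpow_of_lt (by norm_num) hρ
    · filter_upwards [ae_restrict_mem measurableSet_Ioi] with y hy
      have := hρ.trans hy
      positivity
  rw [h1, h2, ← ENNReal.ofReal_add (by positivity) (by positivity)]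
  exact le_of_eq (by ring_nf)

/-- The kernel of the symmetric trilinear Schur test. -/
def chordKernel (s t r : ℝ) : ℝ :=
  |s - t| ^ (3 / 2 : ℝ) * (|s - r| ^ (-(3 / 4) : ℝ) * |t - r| ^ (-(3 / 4) : ℝ))

@[fun_prop]
lemma measurable_chordKernel {α : Type*} [MeasurableSpace α] {u v w : α → ℝ} (hu : Measurable u)
    (hv : Measurable v) (hw : Measurable w) :
    Measurable fun x => chordKernel (u x) (v x) (w x) := by
  unfold chordKernel
  fun_prop

lemma chordKernel_nonneg (s t r : ℝ) : 0 ≤ chordKernel s t r := by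
  unfold chordKernel
  positivity

lemma lintegral_chordKernel_le (s t : ℝ) :
    ∫⁻ r, ENNReal.ofReal (chordKernel s t r) ≤ 48 * ENNReal.ofReal |s - t| := by
  rcases eq_or_ne s t with rfl | hst
  · simp [chordKernel]
  have hd : 0 < |s - t| := abs_pos.2 (sub_ne_zero.2 hst)
  set ρ := |s - t| / 2 with hρ
  have hρ0 : 0 < ρ := by positivity
  set φ : ℝ → ℝ := fun y =>
    if y ≤ ρ then y ^ (-(3 / 4) : ℝ) * ρ ^ (-(3 / 4) : ℝ) else y ^ (-(3 / 2) : ℝ) with hφ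
  have hφ0 : ∀ y, 0 ≤ y → 0 ≤ φ y := by
    intro y hy
    simp only [hφ]
    split_ifs <;> positivity
  have hφm : Measurable φ := by
    refine Measurable.ite measurableSet_Iic ?_ ?_ <;> fun_prop
  have hle : ∀ y z : ℝ, 0 ≤ y → y ≤ z → ρ ≤ z →
      y ^ (-(3 / 4) : ℝ) * z ^ (-(3 / 4) : ℝ) ≤ φ y := by
    intro y z hy hyz hz
    simp only [hφ]
    split_ifs with h
    · gcongr y ^ (-(3 / 4) : ℝ) * ?_
      exact Real.rpow_le_rpow_of_nonpos hρ0 hz (by norm_num)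
    · have hy0 : 0 < y := hρ0.trans (not_le.1 h)
      calc y ^ (-(3 / 4) : ℝ) * z ^ (-(3 / 4) : ℝ)
          ≤ y ^ (-(3 / 4) : ℝ) * y ^ (-(3 / 4) : ℝ) := by
            gcongr y ^ (-(3 / 4) : ℝ) * ?_
            exact Real.rpow_le_rpow_of_nonpos hy0 hyz (by norm_num)
        _ = y ^ (-(3 / 2) : ℝ) := by
            rw [← Real.rpow_add hy0]; norm_num
  have htri : ∀ r, |s - t| ≤ |s - r| + |t - r| := fun r => by
    rw [abs_sub_comm t r]
    exact abs_sub_le s r t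
  have hpt : ∀ r, ENNReal.ofReal (chordKernel s t r) ≤ ENNReal.ofReal (|s - t| ^ (3 / 2 : ℝ)) *
      (ENNReal.ofReal (φ |s - r|) + ENNReal.ofReal (φ |t - r|)) := by
    intro r
    rw [← ENNReal.ofReal_add (hφ0 _ (abs_nonneg _)) (hφ0 _ (abs_nonneg _)),
      ← ENNReal.ofReal_mul (by positivity)]
    refine ENNReal.ofReal_le_ofReal ?_
    unfold chordKernel
    gcongr
    have h1 := hφ0 _ (abs_nonneg (s - r))
    have h2 := hφ0 _ (abs_nonneg (t - r))
    have h3 := htri r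
    rcases le_total |s - r| |t - r| with h | h
    · linarith [hle _ _ (abs_nonneg _) h (by rw [hρ]; linarith)]
    · rw [mul_comm]
      linarith [hle _ _ (abs_nonneg _) h (by rw [hρ]; linarith)]
  have hint : ∀ a : ℝ, ∫⁻ r, ENNReal.ofReal (φ |a - r|)
      ≤ ENNReal.ofReal (12 * ρ ^ (-(1 / 2) : ℝ)) := by
    intro a
    rw [lintegral_sub_left_eq_self (fun y => ENNReal.ofReal (φ |y|)) a,
      lintegral_comp_abs_eq (φ := fun y => ENNReal.ofReal (φ y))]
    calc 2 * ∫⁻ y in Set.Ioi (0 : ℝ), ENNReal.ofReal (φ y)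
        ≤ 2 * ENNReal.ofReal (6 * ρ ^ (-(1 / 2) : ℝ)) := by
          gcongr
          exact lintegral_singular_kernel_le hρ0
      _ = ENNReal.ofReal (12 * ρ ^ (-(1 / 2) : ℝ)) := by
          rw [← ENNReal.ofReal_ofNat 2, ← ENNReal.ofReal_mul (by norm_num)]
          ring_nf
  refine (lintegral_mono hpt).trans ?_
  rw [lintegral_const_mul _ (by fun_prop), lintegral_add_left (by fun_prop)]
  refine (mul_le_mul_right (add_le_add (hint s) (hint t)) _).trans ?_
  rw [← ENNReal.ofReal_add (by positivity) (by positivity), ← ENNReal.ofReal_mul (by positivity),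
    ← ENNReal.ofReal_ofNat 48, ← ENNReal.ofReal_mul (by norm_num)]
  refine ENNReal.ofReal_le_ofReal ?_
  have e1 : |s - t| ^ (3 / 2 : ℝ) * |s - t| ^ (-(1 / 2) : ℝ) = |s - t| := by
    rw [← Real.rpow_add hd]; norm_num
  have e2 : (1 / 2 : ℝ) ^ (-(1 / 2) : ℝ) ≤ 2 := by
    calc (1 / 2 : ℝ) ^ (-(1 / 2) : ℝ) ≤ (1 / 2 : ℝ) ^ (-1 : ℝ) :=
          Real.rpow_le_rpow_of_exponent_ge (by norm_num) (by norm_num) (by norm_num)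
      _ = 2 := by rw [Real.rpow_neg_one]; norm_num
  rw [hρ, show |s - t| / 2 = |s - t| * (1 / 2) by ring, Real.mul_rpow hd.le (by norm_num)]
  calc |s - t| ^ (3 / 2 : ℝ) * (12 * (|s - t| ^ (-(1 / 2) : ℝ) * (1 / 2 : ℝ) ^ (-(1 / 2) : ℝ)) +
        12 * (|s - t| ^ (-(1 / 2) : ℝ) * (1 / 2 : ℝ) ^ (-(1 / 2) : ℝ)))
      = 24 * (1 / 2 : ℝ) ^ (-(1 / 2) : ℝ) *
          (|s - t| ^ (3 / 2 : ℝ) * |s - t| ^ (-(1 / 2) : ℝ)) := by ring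
    _ ≤ 24 * 2 * |s - t| := by rw [e1]; gcongr
    _ = 48 * |s - t| := by ring

lemma chordKernel_mul_eq_one {s t r : ℝ} (hst : s ≠ t) (hsr : s ≠ r) (htr : t ≠ r) :
    chordKernel s t r * chordKernel s r t * chordKernel t r s = 1 := by
  have h1 : 0 < |s - t| := abs_pos.2 (sub_ne_zero.2 hst)
  have h2 : 0 < |s - r| := abs_pos.2 (sub_ne_zero.2 hsr)
  have h3 : 0 < |t - r| := abs_pos.2 (sub_ne_zero.2 htr)
  have key : ∀ x : ℝ, 0 < x →
      x ^ (3 / 2 : ℝ) * (x ^ (-(3 / 4) : ℝ) * x ^ (-(3 / 4) : ℝ)) = 1 := by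
    intro x hx
    rw [← Real.rpow_add hx, ← Real.rpow_add hx]
    norm_num
  unfold chordKernel
  rw [abs_sub_comm r t, abs_sub_comm t s, abs_sub_comm r s]
  calc _ = (|s - t| ^ (3 / 2 : ℝ) * (|s - t| ^ (-(3 / 4) : ℝ) * |s - t| ^ (-(3 / 4) : ℝ))) *
        (|s - r| ^ (3 / 2 : ℝ) * (|s - r| ^ (-(3 / 4) : ℝ) * |s - r| ^ (-(3 / 4) : ℝ))) *
        (|t - r| ^ (3 / 2 : ℝ) * (|t - r| ^ (-(3 / 4) : ℝ) * |t - r| ^ (-(3 / 4) : ℝ))) := by ring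
    _ = 1 := by rw [key _ h1, key _ h2, key _ h3]; norm_num

lemma mul_rpow_third_le (p q w : ℝ≥0∞) {s t r : ℝ} (hst : s ≠ t) (hsr : s ≠ r) (htr : t ≠ r) :
    p ^ (2 / 3 : ℝ) * (q ^ (2 / 3 : ℝ) * w ^ (2 / 3 : ℝ)) ≤
      p * q * ENNReal.ofReal (chordKernel s t r) + p * w * ENNReal.ofReal (chordKernel s r t) +
        q * w * ENNReal.ofReal (chordKernel t r s) := by
  set X := p * q * ENNReal.ofReal (chordKernel s t r) with hX
  set Y := p * w * ENNReal.ofReal (chordKernel s r t) with hY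
  set Z := q * w * ENNReal.ofReal (chordKernel t r s) with hZ
  have hXYZ : X * Y * Z = p ^ (2 : ℝ) * (q ^ (2 : ℝ) * w ^ (2 : ℝ)) := by
    have := congrArg ENNReal.ofReal (chordKernel_mul_eq_one hst hsr htr)
    rw [ENNReal.ofReal_mul (mul_nonneg (chordKernel_nonneg _ _ _) (chordKernel_nonneg _ _ _)),
      ENNReal.ofReal_mul (chordKernel_nonneg _ _ _), ENNReal.ofReal_one] at this
    simp only [ENNReal.rpow_two]
    calc X * Y * Z = p ^ 2 * (q ^ 2 * w ^ 2) * (ENNReal.ofReal (chordKernel s t r) *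
          ENNReal.ofReal (chordKernel s r t) * ENNReal.ofReal (chordKernel t r s)) := by
            rw [hX, hY, hZ]; ring
      _ = _ := by rw [this, mul_one]
  calc p ^ (2 / 3 : ℝ) * (q ^ (2 / 3 : ℝ) * w ^ (2 / 3 : ℝ))
      = (X * Y * Z) ^ (1 / 3 : ℝ) := by
        rw [hXYZ, ENNReal.mul_rpow_of_nonneg _ _ (by norm_num),
          ENNReal.mul_rpow_of_nonneg _ _ (by norm_num), ← ENNReal.rpow_mul, ← ENNReal.rpow_mul,
          ← ENNReal.rpow_mul]
        norm_num
    _ ≤ ((X + Y + Z) * (X + Y + Z) * (X + Y + Z)) ^ (1 / 3 : ℝ) := by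
        gcongr
        · exact (le_add_right le_rfl).trans (le_add_right le_rfl)
        · exact (le_add_left le_rfl).trans (le_add_right le_rfl)
        · exact le_add_left le_rfl
    _ = X + Y + Z := by
        rw [show (X + Y + Z) * (X + Y + Z) * (X + Y + Z) = (X + Y + Z) ^ (3 : ℝ) by
          rw [← Nat.cast_ofNat, ENNReal.rpow_natCast]; ring, ← ENNReal.rpow_mul]
        norm_num

/-- A one-dimensional trilinear Schur test, of Hardy–Littlewood–Sobolev type. -/
lemma lintegral_rpow_cube_le (I : Set ℝ) {p : ℝ → ℝ≥0∞} (hp : Measurable p) :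
    (∫⁻ s in I, p s ^ (2 / 3 : ℝ)) ^ 3 ≤
      144 * ∫⁻ s in I, ∫⁻ t in I, p s * p t * ENNReal.ofReal |s - t| := by
  set μ := volume.restrict I with hμ
  set a : ℝ → ℝ≥0∞ := fun s => p s ^ (2 / 3 : ℝ) with ha
  have ham : Measurable a := by fun_prop
  have hcube : (∫⁻ s, a s ∂μ) ^ 3 = ∫⁻ s, ∫⁻ t, ∫⁻ r, a s * (a t * a r) ∂μ ∂μ ∂μ := by
    have h1 : ∀ c d, ∫⁻ r, c * (d * a r) ∂μ = c * (d * ∫⁻ r, a r ∂μ) := fun c d => by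
      rw [lintegral_const_mul _ (ham.const_mul _), lintegral_const_mul _ ham]
    have h2 : ∀ c d, ∫⁻ r, c * (a r * d) ∂μ = c * ((∫⁻ r, a r ∂μ) * d) := fun c d => by
      rw [lintegral_const_mul _ (ham.mul_const _), lintegral_mul_const _ ham]
    simp_rw [h1, h2]
    rw [lintegral_mul_const _ ham]
    ring
  set J := ∫⁻ s, ∫⁻ t, ∫⁻ r, p s * p t * ENNReal.ofReal (chordKernel s t r) ∂μ ∂μ ∂μ with hJ
  have hJle : J ≤ 48 * ∫⁻ s, ∫⁻ t, p s * p t * ENNReal.ofReal |s - t| ∂μ ∂μ := by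
    rw [← lintegral_const_mul _ (by fun_prop)]
    refine lintegral_mono fun s => ?_
    rw [← lintegral_const_mul _ (by fun_prop)]
    refine lintegral_mono fun t => ?_
    rw [lintegral_const_mul _ (by fun_prop)]
    calc p s * p t * ∫⁻ r, ENNReal.ofReal (chordKernel s t r) ∂μ
        ≤ p s * p t * (48 * ENNReal.ofReal |s - t|) := by
          gcongr
          exact (setLIntegral_le_lintegral _ _).trans (lintegral_chordKernel_le s t)
      _ = 48 * (p s * p t * ENNReal.ofReal |s - t|) := by ring
  have hJ2 : ∫⁻ s, ∫⁻ t, ∫⁻ r, p s * p r * ENNReal.ofReal (chordKernel s r t) ∂μ ∂μ ∂μ = J := by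
    refine lintegral_congr fun s => ?_
    exact lintegral_lintegral_swap (by fun_prop)
  have hJ3 : ∫⁻ s, ∫⁻ t, ∫⁻ r, p t * p r * ENNReal.ofReal (chordKernel t r s) ∂μ ∂μ ∂μ = J := by
    rw [lintegral_lintegral_swap (by fun_prop)]
    refine lintegral_congr fun t => ?_
    exact lintegral_lintegral_swap (by fun_prop)
  have hne : ∀ x : ℝ, ∀ᵐ y ∂μ, x ≠ y := fun x => by
    filter_upwards [Measure.ae_ne μ x] with y hy using hy.symm
  have hsum : (∫⁻ s, a s ∂μ) ^ 3 ≤ J + J + J := by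
    rw [hcube]
    calc _ ≤ ∫⁻ s, ∫⁻ t, ∫⁻ r, (p s * p t * ENNReal.ofReal (chordKernel s t r) +
          p s * p r * ENNReal.ofReal (chordKernel s r t) +
          p t * p r * ENNReal.ofReal (chordKernel t r s)) ∂μ ∂μ ∂μ := by
          refine lintegral_mono fun s => lintegral_mono_ae ?_
          filter_upwards [hne s] with t hst
          refine lintegral_mono_ae ?_
          filter_upwards [hne s, hne t] with r hsr htr
          exact mul_rpow_third_le (p s) (p t) (p r) hst hsr htr
      _ = J + ∫⁻ s, ∫⁻ t, ∫⁻ r, p s * p r * ENNReal.ofReal (chordKernel s r t) ∂μ ∂μ ∂μ +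
          ∫⁻ s, ∫⁻ t, ∫⁻ r, p t * p r * ENNReal.ofReal (chordKernel t r s) ∂μ ∂μ ∂μ := by
          rw [hJ, ← lintegral_add_left (by fun_prop), ← lintegral_add_left (by fun_prop)]
          refine lintegral_congr fun s => ?_
          rw [← lintegral_add_left (by fun_prop), ← lintegral_add_left (by fun_prop)]
          refine lintegral_congr fun t => ?_
          rw [← lintegral_add_left (by fun_prop), ← lintegral_add_left (by fun_prop)]
      _ = J + J + J := by rw [hJ2, hJ3]
  calc (∫⁻ s, a s ∂μ) ^ 3 ≤ 3 * J := hsum.trans (le_of_eq (by ring))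
    _ ≤ 3 * (48 * ∫⁻ s, ∫⁻ t, p s * p t * ENNReal.ofReal |s - t| ∂μ ∂μ) := by gcongr
    _ = _ := by rw [← mul_assoc]; norm_num

lemma lintegral_arc_transversal_le {β γ : ℝ} (hβγ : β - γ = π / 3) (b : ℝ)
    {G : EuclideanSpace ℝ (Fin 2) → ℝ≥0∞} (hG : Measurable G) :
    ∫⁻ s in Set.Ico b (b + 1 / 2), ∫⁻ t in Set.Ico b (b + 1 / 2),
      G (circlePoint (s + β) - circlePoint (t + γ)) ≤ 3 * ∫⁻ x, G x := by
  set I := Set.Ico b (b + 1 / 2) with hI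
  have hπ := Real.pi_gt_three
  have hD : MeasurableSet (I ×ˢ I) := measurableSet_Ico.prod measurableSet_Ico
  have hdiff : ∀ p ∈ I ×ˢ I, π / 3 - 1 / 2 ≤ (p.1 + β) - (p.2 + γ) ∧
      (p.1 + β) - (p.2 + γ) ≤ π / 2 := by
    rintro ⟨s, t⟩ ⟨hs, ht⟩
    simp only [hI, Set.mem_Ico] at hs ht ⊢
    constructor <;> linarith
  rw [← lintegral_prod (fun p : ℝ × ℝ => G (circlePoint (p.1 + β) - circlePoint (p.2 + γ)))
    (by fun_prop), Measure.prod_restrict, ← Measure.volume_eq_prod]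
  calc _ ≤ ∫⁻ p in I ×ˢ I, 3 * (ENNReal.ofReal (Real.sin ((p.1 + β) - (p.2 + γ))) *
      G (circlePoint (p.1 + β) - circlePoint (p.2 + γ))) := by
        refine setLIntegral_mono' hD fun p hp => ?_
        rw [← mul_assoc]
        refine le_mul_of_one_le_left zero_le ?_
        rw [← ENNReal.ofReal_ofNat 3, ← ENNReal.ofReal_mul (by norm_num), ← ENNReal.ofReal_one]
        refine ENNReal.ofReal_le_ofReal ?_
        obtain ⟨h1, h2⟩ := hdiff p hp
        have h3 := Real.mul_le_sin (by linarith) h2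
        have h4 : 2 / π * (π / 3 - 1 / 2) ≤ 2 / π * ((p.1 + β) - (p.2 + γ)) := by gcongr
        have h5 : 2 / π * (π / 3 - 1 / 2) = 2 / 3 - 1 / π := by field_simp
        have h6 : 1 / π ≤ 1 / 3 := by gcongr
        linarith
    _ = 3 * ∫⁻ p in I ×ˢ I, ENNReal.ofReal (Real.sin ((p.1 + β) - (p.2 + γ))) *
          G (circlePoint (p.1 + β) - circlePoint (p.2 + γ)) :=
        lintegral_const_mul _ (by fun_prop)
    _ ≤ 3 * ∫⁻ x, G x := by
        gcongr
        refine lintegral_circlePoint_sub_le (A := 2 * b) hD ?_ ?_ ?_ ?_ G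
        · intro p hp
          linarith [(hdiff p hp).1]
        · intro p hp
          linarith [(hdiff p hp).2]
        all_goals
          rintro ⟨s, t⟩ ⟨hs, ht⟩
          simp only [hI, Set.mem_Ico] at hs ht ⊢
          linarith

lemma lintegral_arc_lower_le (β b : ℝ) {G : EuclideanSpace ℝ (Fin 2) → ℝ≥0∞}
    (hG : Measurable G) :
    ∫⁻ s in Set.Ico b (b + 1), ∫⁻ t in Set.Ico b (b + 1), (Set.Ioi t).indicator
      (fun s => ENNReal.ofReal |s - t| * G (circlePoint (s + β) - circlePoint (t + β))) s
      ≤ 2 * ∫⁻ x, G x := by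
  set I := Set.Ico b (b + 1) with hI
  have hπ := Real.pi_gt_three
  have hL : MeasurableSet {p : ℝ × ℝ | p.2 < p.1} := measurableSet_lt measurable_snd measurable_fst
  have hD : MeasurableSet ((I ×ˢ I) ∩ {p : ℝ × ℝ | p.2 < p.1}) :=
    (measurableSet_Ico.prod measurableSet_Ico).inter hL
  have hdiff : ∀ p ∈ (I ×ˢ I) ∩ {p : ℝ × ℝ | p.2 < p.1}, 0 < p.1 - p.2 ∧ p.1 - p.2 < 1 := by
    rintro ⟨s, t⟩ ⟨⟨hs, ht⟩, hst⟩
    simp only [hI, Set.mem_Ico, Set.mem_ofPred_eq] at hs ht hst ⊢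
    constructor <;> linarith
  have hm : Measurable fun p : ℝ × ℝ =>
      ENNReal.ofReal |p.1 - p.2| * G (circlePoint (p.1 + β) - circlePoint (p.2 + β)) := by fun_prop
  have hind : ∀ s t : ℝ, (Set.Ioi t).indicator
      (fun s => ENNReal.ofReal |s - t| * G (circlePoint (s + β) - circlePoint (t + β))) s =
      {p : ℝ × ℝ | p.2 < p.1}.indicator (fun p : ℝ × ℝ =>
        ENNReal.ofReal |p.1 - p.2| * G (circlePoint (p.1 + β) - circlePoint (p.2 + β))) (s, t) :=
    fun s t => by simp [Set.indicator_apply]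
  simp_rw [hind]
  rw [← lintegral_prod ({p : ℝ × ℝ | p.2 < p.1}.indicator _) (hm.indicator hL).aemeasurable,
    Measure.prod_restrict, ← Measure.volume_eq_prod, setLIntegral_indicator hL, Set.inter_comm]
  calc _ ≤ ∫⁻ p in (I ×ˢ I) ∩ {p : ℝ × ℝ | p.2 < p.1},
        2 * (ENNReal.ofReal (Real.sin ((p.1 + β) - (p.2 + β))) *
          G (circlePoint (p.1 + β) - circlePoint (p.2 + β))) := by
        refine setLIntegral_mono' hD fun p hp => ?_
        rw [← mul_assoc]
        gcongr
        rw [← ENNReal.ofReal_ofNat 2, ← ENNReal.ofReal_mul (by norm_num)]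
        refine ENNReal.ofReal_le_ofReal ?_
        obtain ⟨h1, h2⟩ := hdiff p hp
        rw [abs_of_pos h1, add_sub_add_right_eq_sub]
        have h3 := Real.mul_le_sin h1.le (by linarith)
        have h4 : 1 / 2 * (p.1 - p.2) ≤ 2 / π * (p.1 - p.2) := by
          gcongr ?_ * _
          rw [div_le_div_iff₀ (by norm_num) (by linarith)]
          linarith [Real.pi_le_four]
        linarith
    _ = 2 * ∫⁻ p in (I ×ˢ I) ∩ {p : ℝ × ℝ | p.2 < p.1},
          ENNReal.ofReal (Real.sin ((p.1 + β) - (p.2 + β))) *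
            G (circlePoint (p.1 + β) - circlePoint (p.2 + β)) :=
        lintegral_const_mul _ (by fun_prop)
    _ ≤ 2 * ∫⁻ x, G x := by
        gcongr
        refine lintegral_circlePoint_sub_le (A := 2 * b) hD ?_ ?_ ?_ ?_ G
        · intro p hp
          linarith [(hdiff p hp).1]
        · intro p hp
          linarith [(hdiff p hp).2]
        all_goals
          rintro ⟨s, t⟩ ⟨⟨hs, ht⟩, -⟩
          simp only [hI, Set.mem_Ico] at hs ht ⊢
          linarith

lemma lintegral_arc_chord_le (β b : ℝ) {G : EuclideanSpace ℝ (Fin 2) → ℝ≥0∞}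
    (hG : Measurable G) :
    ∫⁻ s in Set.Ico b (b + 1), ∫⁻ t in Set.Ico b (b + 1),
      ENNReal.ofReal |s - t| * G (circlePoint (s + β) - circlePoint (t + β))
      ≤ 4 * ∫⁻ x, G x := by
  set I := Set.Ico b (b + 1) with hI
  have hlow := lintegral_arc_lower_le β b hG
  have hup := lintegral_arc_lower_le β b (hG.comp measurable_neg)
  rw [← hI] at hlow hup
  simp only [Function.comp_apply, neg_sub] at hup
  have hmeas : ∀ {H : EuclideanSpace ℝ (Fin 2) → ℝ≥0∞}, Measurable H →
      Measurable fun p : ℝ × ℝ => (Set.Ioi p.2).indicator (fun s => ENNReal.ofReal |s - p.2| *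
        H (circlePoint (s + β) - circlePoint (p.2 + β))) p.1 := by
    intro H hH
    have : Measurable ({p : ℝ × ℝ | p.2 < p.1}.indicator fun p : ℝ × ℝ =>
        ENNReal.ofReal |p.1 - p.2| * H (circlePoint (p.1 + β) - circlePoint (p.2 + β))) :=
      Measurable.indicator (by fun_prop) (measurableSet_lt measurable_snd measurable_fst)
    convert this using 2 with p
    simp [Set.indicator_apply]
  have hm := hmeas hG
  have hm' := hmeas (hG.comp measurable_neg)
  simp only [Function.comp_apply, neg_sub] at hm'
  rw [lintegral_lintegral_swap hm'.aemeasurable] at hup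
  rw [lintegral_neg_eq_self] at hup
  calc _ ≤ ∫⁻ s in I, ∫⁻ t in I, ((Set.Ioi t).indicator (fun s => ENNReal.ofReal |s - t| *
          G (circlePoint (s + β) - circlePoint (t + β))) s +
        (Set.Ioi s).indicator (fun t => ENNReal.ofReal |t - s| *
          G (circlePoint (s + β) - circlePoint (t + β))) t) := by
        refine lintegral_mono fun s => lintegral_mono fun t => ?_
        rcases lt_trichotomy s t with h | rfl | h
        · simp [h, abs_sub_comm s t]
        · simp
        · simp [h]
    _ ≤ (2 * ∫⁻ x, G x) + 2 * ∫⁻ x, G x := by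
        refine le_trans (le_of_eq ?_) (add_le_add hlow hup)
        rw [← lintegral_add_left]
        · refine lintegral_congr fun s => ?_
          rw [lintegral_add_left]
          exact hm.comp (measurable_const.prodMk measurable_id)
        · exact hm.lintegral_prod_right'
    _ = 4 * ∫⁻ x, G x := by ring

/-- A bound for averages over difference vectors `u s - v t` tested against one function upgrades
to a bilinear bound. -/
lemma lintegral_pairing_le {μ : Measure ℝ} [SFinite μ] {u v : ℝ → EuclideanSpace ℝ (Fin 2)}
    (hu : Measurable u) (hv : Measurable v) {κ : ℝ → ℝ → ℝ≥0∞}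
    (hκ : Measurable fun p : ℝ × ℝ => κ p.1 p.2) {K : ℝ≥0∞}
    (H : ∀ G : EuclideanSpace ℝ (Fin 2) → ℝ≥0∞, Measurable G →
      ∫⁻ s, ∫⁻ t, κ s t * G (u s - v t) ∂μ ∂μ ≤ K * ∫⁻ x, G x)
    {P Q : EuclideanSpace ℝ (Fin 2) → ℝ≥0∞} (hP : Measurable P) (hQ : Measurable Q) :
    ∫⁻ x, ∫⁻ s, ∫⁻ t, κ s t * (P (x - u s) * Q (x - v t)) ∂μ ∂μ ≤
      K * ((∫⁻ x, P x) * ∫⁻ x, Q x) := by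
  have hshift : ∀ s t, ∫⁻ x, κ s t * (P (x - u s) * Q (x - v t)) =
      ∫⁻ x, P x * (κ s t * Q (x + (u s - v t))) := by
    intro s t
    rw [← lintegral_sub_right_eq_self (fun x => P x * (κ s t * Q (x + (u s - v t)))) (u s)]
    refine lintegral_congr fun x => ?_
    rw [show x - u s + (u s - v t) = x - v t by abel]
    ring
  calc _ = ∫⁻ s, ∫⁻ t, (∫⁻ x, κ s t * (P (x - u s) * Q (x - v t))) ∂μ ∂μ := by
        rw [lintegral_lintegral_swap (by fun_prop)]
        refine lintegral_congr fun s => ?_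
        rw [lintegral_lintegral_swap (by fun_prop)]
    _ = ∫⁻ s, ∫⁻ t, (∫⁻ x, P x * (κ s t * Q (x + (u s - v t)))) ∂μ ∂μ := by simp_rw [hshift]
    _ = ∫⁻ x, ∫⁻ s, ∫⁻ t, P x * (κ s t * Q (x + (u s - v t))) ∂μ ∂μ := by
        symm
        rw [lintegral_lintegral_swap (by fun_prop)]
        refine lintegral_congr fun s => ?_
        rw [lintegral_lintegral_swap (by fun_prop)]
    _ ≤ ∫⁻ x, P x * (K * ∫⁻ z, Q z) := by
        refine lintegral_mono fun x => ?_
        calc _ = P x * ∫⁻ s, ∫⁻ t, κ s t * Q (x + (u s - v t)) ∂μ ∂μ := by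
              rw [← lintegral_const_mul _ (by fun_prop)]
              refine lintegral_congr fun s => ?_
              rw [← lintegral_const_mul _ (by fun_prop)]
          _ ≤ P x * (K * ∫⁻ z, Q z) := by
              gcongr
              refine (H (fun z => Q (x + z)) (by fun_prop)).trans (le_of_eq ?_)
              rw [lintegral_add_left_eq_self]
    _ = K * ((∫⁻ x, P x) * ∫⁻ x, Q x) := by
        rw [lintegral_mul_const _ hP]
        ring

/-- Covering the full circle by `n` arcs of length `ℓ`. -/
lemma lintegral_circle_le_of_arc {n : ℕ} {ℓ : ℝ} (hℓ : 0 < ℓ) (hn : 2 * π ≤ n * ℓ)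
    {Φ : ℝ → ℝ≥0∞} {K : ℝ≥0∞} (h : ∀ b, ∫⁻ s in Set.Ico b (b + ℓ), Φ s ≤ K) :
    ∫⁻ s in Set.Ico 0 (2 * π), Φ s ≤ n * K := by
  have hsub : Set.Ico 0 (2 * π) ⊆ ⋃ i : Fin n, Set.Ico (i * ℓ) (i * ℓ + ℓ) := by
    rintro s ⟨hs0, hs1⟩
    have hq : 0 ≤ s / ℓ := by positivity
    have hlt : ⌊s / ℓ⌋₊ < n := by
      rw [Nat.floor_lt hq, div_lt_iff₀ hℓ]
      linarith
    refine Set.mem_iUnion.2 ⟨⟨_, hlt⟩, ?_, ?_⟩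
    · exact (le_div_iff₀ hℓ).1 (Nat.floor_le hq)
    · have := (div_lt_iff₀ hℓ).1 (Nat.lt_floor_add_one (s / ℓ))
      simp only
      linarith
  calc _ ≤ ∫⁻ s in ⋃ i : Fin n, Set.Ico (i * ℓ) (i * ℓ + ℓ), Φ s := lintegral_mono_set hsub
    _ ≤ ∑' i : Fin n, ∫⁻ s in Set.Ico (i * ℓ) (i * ℓ + ℓ), Φ s := lintegral_iUnion_le _ _
    _ ≤ ∑' _ : Fin n, K := ENNReal.tsum_le_tsum fun i => h _
    _ = n * K := by simp [tsum_fintype]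

/-- The `L^{3/2} × L^{3/2}` bound for the circular averaging form. -/
lemma lintegral_circle_average_le (β : ℝ) {f g : EuclideanSpace ℝ (Fin 2) → ℝ≥0∞}
    (hf : Measurable f) (hg : Measurable g) :
    ∫⁻ s in Set.Ico 0 (2 * π), ∫⁻ x, f x * g (x - circlePoint (s + β)) ≤
      63 * ((∫⁻ x, f x ^ (3 / 2 : ℝ)) ^ (2 / 3 : ℝ) * (∫⁻ x, g x ^ (3 / 2 : ℝ)) ^ (2 / 3 : ℝ)) := by
  set X := (∫⁻ x, f x ^ (3 / 2 : ℝ)) ^ (2 / 3 : ℝ)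
  set Y := ∫⁻ x, g x ^ (3 / 2 : ℝ) with hY
  rw [show (63 : ℝ≥0∞) * (X * Y ^ (2 / 3 : ℝ)) = (7 : ℕ) * (X * (9 * Y ^ (2 / 3 : ℝ))) by
    push_cast; ring]
  refine lintegral_circle_le_of_arc one_pos
    (by push_cast; linarith [Real.pi_lt_d2]) fun b => ?_
  set I := Set.Ico b (b + 1) with hI
  have hp : ∀ x, Measurable fun s => g (x - circlePoint (s + β)) ^ (3 / 2 : ℝ) := by
    intro x
    fun_prop
  have hA : ∀ x, (∫⁻ s in I, g (x - circlePoint (s + β))) ^ 3 ≤ 144 * ∫⁻ s in I, ∫⁻ t in I,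
      ENNReal.ofReal |s - t| * (g (x - circlePoint (s + β)) ^ (3 / 2 : ℝ) *
        g (x - circlePoint (t + β)) ^ (3 / 2 : ℝ)) := by
    intro x
    have := lintegral_rpow_cube_le I (hp x)
    simp_rw [← ENNReal.rpow_mul] at this
    norm_num at this
    simpa only [mul_comm (ENNReal.ofReal _)] using this
  have hA3 : ∫⁻ x, (∫⁻ s in I, g (x - circlePoint (s + β))) ^ (3 : ℝ) ≤ 576 * (Y * Y) := by
    calc _ ≤ ∫⁻ x, 144 * ∫⁻ s in I, ∫⁻ t in I,
          ENNReal.ofReal |s - t| * (g (x - circlePoint (s + β)) ^ (3 / 2 : ℝ) *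
            g (x - circlePoint (t + β)) ^ (3 / 2 : ℝ)) := by
          refine lintegral_mono fun x => ?_
          exact_mod_cast hA x
      _ = 144 * ∫⁻ x, ∫⁻ s in I, ∫⁻ t in I,
          ENNReal.ofReal |s - t| * (g (x - circlePoint (s + β)) ^ (3 / 2 : ℝ) *
            g (x - circlePoint (t + β)) ^ (3 / 2 : ℝ)) := lintegral_const_mul _ (by fun_prop)
      _ ≤ 144 * (4 * (Y * Y)) := by
          gcongr
          exact lintegral_pairing_le (P := fun x => g x ^ (3 / 2 : ℝ))
            (Q := fun x => g x ^ (3 / 2 : ℝ)) (κ := fun s t => ENNReal.ofReal |s - t|)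
            (u := fun s => circlePoint (s + β)) (v := fun s => circlePoint (s + β))
            (by fun_prop) (by fun_prop) (by fun_prop)
            (fun G hG => lintegral_arc_chord_le β b hG) (by fun_prop) (by fun_prop)
      _ = 576 * (Y * Y) := by ring
  calc _ = ∫⁻ x, f x * ∫⁻ s in I, g (x - circlePoint (s + β)) := by
        rw [lintegral_lintegral_swap (by fun_prop)]
        refine lintegral_congr fun x => lintegral_const_mul _ (by fun_prop)
    _ ≤ (∫⁻ x, f x ^ (3 / 2 : ℝ)) ^ (1 / (3 / 2) : ℝ) *
        (∫⁻ x, (∫⁻ s in I, g (x - circlePoint (s + β))) ^ (3 : ℝ)) ^ (1 / 3 : ℝ) :=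
        ENNReal.lintegral_mul_le_Lp_mul_Lq volume
          ((Real.holderConjugate_iff).2 ⟨by norm_num, by norm_num⟩) hf.aemeasurable
          (Measurable.aemeasurable (by fun_prop))
    _ ≤ X * (729 * (Y * Y)) ^ (1 / 3 : ℝ) := by
        rw [show (1 / (3 / 2) : ℝ) = 2 / 3 by norm_num]
        gcongr
        refine hA3.trans ?_
        gcongr
        norm_num
    _ = X * (9 * Y ^ (2 / 3 : ℝ)) := by
        rw [ENNReal.mul_rpow_of_nonneg _ _ (by norm_num : (0 : ℝ) ≤ 1 / 3), ← pow_two,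
          ← ENNReal.rpow_natCast, ← ENNReal.rpow_mul,
          show (729 : ℝ≥0∞) = 9 ^ (3 : ℝ) by norm_cast, ← ENNReal.rpow_mul]
        norm_num

/-- The Loomis–Whitney type `L² × L² × L²` bound. -/
lemma lintegral_circle_transversal_le {β γ : ℝ} (hβγ : β - γ = π / 3)
    {f g h : EuclideanSpace ℝ (Fin 2) → ℝ≥0∞}
    (hf : Measurable f) (hg : Measurable g) (hh : Measurable h) :
    ∫⁻ s in Set.Ico 0 (2 * π),
      ∫⁻ x, f x * (g (x - circlePoint (s + β)) * h (x - circlePoint (s + γ))) ≤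
      26 * ((∫⁻ x, f x ^ (2 : ℝ)) ^ (1 / 2 : ℝ) * ((∫⁻ x, g x ^ (2 : ℝ)) ^ (1 / 2 : ℝ) *
        (∫⁻ x, h x ^ (2 : ℝ)) ^ (1 / 2 : ℝ))) := by
  set X := (∫⁻ x, f x ^ (2 : ℝ)) ^ (1 / 2 : ℝ)
  set Y := ∫⁻ x, g x ^ (2 : ℝ) with hY
  set Z := ∫⁻ x, h x ^ (2 : ℝ) with hZ
  rw [show (26 : ℝ≥0∞) * (X * (Y ^ (1 / 2 : ℝ) * Z ^ (1 / 2 : ℝ))) =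
    (13 : ℕ) * (X * (2 * (Y ^ (1 / 2 : ℝ) * Z ^ (1 / 2 : ℝ)))) by push_cast; ring]
  refine lintegral_circle_le_of_arc (ℓ := 1 / 2) (by norm_num)
    (by push_cast; linarith [Real.pi_lt_d2]) fun b => ?_
  set I := Set.Ico b (b + 1 / 2) with hI
  have hconj : (2 : ℝ).HolderConjugate 2 := Real.holderConjugate_iff.2 ⟨by norm_num, by norm_num⟩
  have hB : ∀ x, (∫⁻ s in I, g (x - circlePoint (s + β)) * h (x - circlePoint (s + γ))) ^ (2 : ℝ) ≤
      ∫⁻ s in I, ∫⁻ t in I, 1 * (g (x - circlePoint (s + β)) ^ (2 : ℝ) *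
        h (x - circlePoint (t + γ)) ^ (2 : ℝ)) := by
    intro x
    have := ENNReal.lintegral_mul_le_Lp_mul_Lq (volume.restrict I) hconj
      (f := fun s => g (x - circlePoint (s + β))) (g := fun s => h (x - circlePoint (s + γ)))
      (Measurable.aemeasurable (by fun_prop)) (Measurable.aemeasurable (by fun_prop))
    rw [← ENNReal.mul_rpow_of_nonneg _ _ (by norm_num : (0 : ℝ) ≤ 1 / 2)] at this
    refine (ENNReal.rpow_le_rpow this zero_le_two).trans (le_of_eq ?_)
    rw [← ENNReal.rpow_mul, one_div_mul_cancel (two_ne_zero' ℝ), ENNReal.rpow_one,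
      ← lintegral_mul_const _ (by fun_prop)]
    refine lintegral_congr fun s => ?_
    rw [← lintegral_const_mul _ (by fun_prop)]
    simp
  have hB2 : ∫⁻ x, (∫⁻ s in I, g (x - circlePoint (s + β)) * h (x - circlePoint (s + γ))) ^ (2 : ℝ)
      ≤ 3 * (Y * Z) :=
    (lintegral_mono hB).trans <| lintegral_pairing_le (P := fun x => g x ^ (2 : ℝ))
      (Q := fun x => h x ^ (2 : ℝ)) (κ := fun _ _ => 1)
      (u := fun s => circlePoint (s + β)) (v := fun s => circlePoint (s + γ))
      (by fun_prop) (by fun_prop) (by fun_prop)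
      (fun G hG => by simpa only [one_mul] using lintegral_arc_transversal_le hβγ b hG)
      (by fun_prop) (by fun_prop)
  calc _ = ∫⁻ x, f x * ∫⁻ s in I, g (x - circlePoint (s + β)) * h (x - circlePoint (s + γ)) := by
        rw [lintegral_lintegral_swap (by fun_prop)]
        refine lintegral_congr fun x => lintegral_const_mul _ (by fun_prop)
    _ ≤ X * (∫⁻ x, (∫⁻ s in I, g (x - circlePoint (s + β)) *
          h (x - circlePoint (s + γ))) ^ (2 : ℝ)) ^ (1 / 2 : ℝ) :=
        ENNReal.lintegral_mul_le_Lp_mul_Lq volume hconj hf.aemeasurable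
          (Measurable.aemeasurable (by fun_prop))
    _ ≤ X * (4 * (Y * Z)) ^ (1 / 2 : ℝ) := by
        gcongr
        refine hB2.trans ?_
        gcongr
        norm_num
    _ = X * (2 * (Y ^ (1 / 2 : ℝ) * Z ^ (1 / 2 : ℝ))) := by
        rw [ENNReal.mul_rpow_of_nonneg _ _ (by norm_num : (0 : ℝ) ≤ 1 / 2),
          ENNReal.mul_rpow_of_nonneg _ _ (by norm_num : (0 : ℝ) ≤ 1 / 2),
          show (4 : ℝ≥0∞) = 2 ^ (2 : ℝ) by norm_cast, ← ENNReal.rpow_mul]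
        norm_num

/-- The `L^{1/a}` norm, with `L^{1/0} = L^∞`. -/
def recipNorm {E : Type*} [MeasureSpace E] (a : ℝ) (F : E → ℝ≥0∞) : ℝ≥0∞ :=
  eLpNorm F (ENNReal.ofReal a)⁻¹ volume

lemma recipNorm_zero {E : Type*} [MeasureSpace E] (F : E → ℝ≥0∞) :
    recipNorm 0 F = essSup F volume := by
  simp [recipNorm, eLpNormEssSup]

lemma recipNorm_of_pos {E : Type*} [MeasureSpace E] {a : ℝ} (ha : 0 < a) (F : E → ℝ≥0∞) :
    recipNorm a F = (∫⁻ x, F x ^ a⁻¹) ^ a := by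
  rw [recipNorm, eLpNorm_eq_lintegral_rpow_enorm_toReal (by simp) (by simpa using ha)]
  simp [ENNReal.toReal_inv, ENNReal.toReal_ofReal ha.le]

lemma recipNorm_rpow_le {E : Type*} [MeasureSpace E] {a c : ℝ} (ha : 0 ≤ a) (hc : 0 < c)
    (F : E → ℝ≥0∞) : recipNorm a (fun x => F x ^ (a / c)) ≤ recipNorm c F ^ (a / c) := by
  rcases ha.eq_or_lt with rfl | ha
  · simp only [zero_div, ENNReal.rpow_zero, recipNorm_zero]
    exact essSup_le_of_ae_le _ (Filter.Eventually.of_forall fun _ => le_rfl)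
  · rw [recipNorm_of_pos ha, recipNorm_of_pos hc, ← ENNReal.rpow_mul]
    simp_rw [← ENNReal.rpow_mul]
    rw [mul_div_cancel₀ _ hc.ne', div_mul_eq_mul_div, mul_inv_cancel₀ ha.ne', one_div]

lemma nnLpNorm_eq_recipNorm {d : ℕ} (a : ℝ) (f : EuclideanSpace ℝ (Fin d) → ℝ≥0) :
    nnLpNorm' (ENNReal.ofReal a)⁻¹ f = recipNorm a fun x => (f x : ℝ≥0∞) :=
  eLpNorm_congr_enorm_ae (Filter.Eventually.of_forall fun x => by simp)

/-- The set of reciprocal exponents for which the positive multilinear form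
`F ↦ ∫ ∏ i, F i (τ i z) dω(z)` is bounded. -/
def boundedExponents {ι Ω E : Type*} [Fintype ι] [MeasurableSpace Ω] [MeasureSpace E]
    (ω : Measure Ω) (τ : ι → Ω → E) : Set (ι → ℝ) :=
  {a | (∀ i, 0 ≤ a i) ∧ ∃ C : ℝ≥0∞, C ≠ ⊤ ∧ ∀ F : ι → E → ℝ≥0∞, (∀ i, Measurable (F i)) →
    ∫⁻ z, ∏ i, F i (τ i z) ∂ω ≤ C * ∏ i, recipNorm (a i) (F i)}

/-- Interpolation for positive multilinear forms, by Hölder's inequality. -/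
lemma convex_boundedExponents {ι Ω E : Type*} [Fintype ι] [MeasurableSpace Ω] [MeasureSpace E]
    {ω : Measure Ω} {τ : ι → Ω → E} (hτ : ∀ i, Measurable (τ i)) :
    Convex ℝ (boundedExponents ω τ) := by
  refine convex_iff_forall_pos.2 ?_
  rintro a ⟨ha, C, hC, hCF⟩ b ⟨hb, D, hD, hDF⟩ s t hs ht hst
  set c := s • a + t • b with hc_def
  have hci : ∀ i, c i = s * a i + t * b i := fun i => by simp [hc_def]
  have hc : ∀ i, 0 ≤ c i := fun i => by
    rw [hci]
    have := ha i
    have := hb i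
    positivity
  refine ⟨hc, C ^ s * D ^ t, ENNReal.mul_ne_top (ENNReal.rpow_ne_top_of_nonneg hs.le hC)
    (ENNReal.rpow_ne_top_of_nonneg ht.le hD), fun F hF => ?_⟩
  have split : ∀ i, ∃ G H : E → ℝ≥0∞, Measurable G ∧ Measurable H ∧
      (∀ x, F i x = G x ^ s * H x ^ t) ∧
      recipNorm (a i) G ^ s * recipNorm (b i) H ^ t ≤ recipNorm (c i) (F i) := by
    intro i
    rcases (hc i).eq_or_lt with h0 | hpos
    · have hmul_a : 0 ≤ s * a i := mul_nonneg hs.le (ha i)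
      have hmul_b : 0 ≤ t * b i := mul_nonneg ht.le (hb i)
      have hai : a i = 0 := by
        have : s * a i = 0 := by linarith [hci i]
        exact (mul_eq_zero.1 this).resolve_left hs.ne'
      have hbi : b i = 0 := by
        have : t * b i = 0 := by linarith [hci i]
        exact (mul_eq_zero.1 this).resolve_left ht.ne'
      refine ⟨F i, F i, hF i, hF i, fun x => ?_, ?_⟩
      · rw [← ENNReal.rpow_add_of_nonneg _ _ hs.le ht.le, hst, ENNReal.rpow_one]
      · rw [hai, hbi, ← h0, ← ENNReal.rpow_add_of_nonneg _ _ hs.le ht.le, hst, ENNReal.rpow_one]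
    · have hsum : a i / c i * s + b i / c i * t = 1 := by
        rw [div_mul_eq_mul_div, div_mul_eq_mul_div, ← add_div, div_eq_one_iff_eq hpos.ne', hci]
        ring
      have hqa : 0 ≤ a i / c i * s := mul_nonneg (div_nonneg (ha i) (hc i)) hs.le
      have hqb : 0 ≤ b i / c i * t := mul_nonneg (div_nonneg (hb i) (hc i)) ht.le
      refine ⟨fun x => F i x ^ (a i / c i), fun x => F i x ^ (b i / c i),
        (hF i).pow_const _, (hF i).pow_const _, fun x => ?_, ?_⟩
      · rw [← ENNReal.rpow_mul, ← ENNReal.rpow_mul, ← ENNReal.rpow_add_of_nonneg _ _ hqa hqb,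
          hsum, ENNReal.rpow_one]
      · calc _ ≤ (recipNorm (c i) (F i) ^ (a i / c i)) ^ s *
              (recipNorm (c i) (F i) ^ (b i / c i)) ^ t := by
              gcongr
              · exact recipNorm_rpow_le (ha i) hpos _
              · exact recipNorm_rpow_le (hb i) hpos _
          _ = recipNorm (c i) (F i) := by
              rw [← ENNReal.rpow_mul, ← ENNReal.rpow_mul,
                ← ENNReal.rpow_add_of_nonneg _ _ hqa hqb, hsum, ENNReal.rpow_one]
  choose G H hG hH hFGH hN using split
  have hGτ : Measurable fun z => ∏ i, G i (τ i z) :=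
    Finset.measurable_prod _ fun i _ => (hG i).comp (hτ i)
  have hHτ : Measurable fun z => ∏ i, H i (τ i z) :=
    Finset.measurable_prod _ fun i _ => (hH i).comp (hτ i)
  calc _ = ∫⁻ z, (∏ i, G i (τ i z)) ^ s * (∏ i, H i (τ i z)) ^ t ∂ω := by
        refine lintegral_congr fun z => ?_
        rw [← ENNReal.prod_rpow_of_nonneg hs.le, ← ENNReal.prod_rpow_of_nonneg ht.le,
          ← Finset.prod_mul_distrib]
        exact Finset.prod_congr rfl fun i _ => hFGH i _
    _ ≤ (∫⁻ z, ∏ i, G i (τ i z) ∂ω) ^ s * (∫⁻ z, ∏ i, H i (τ i z) ∂ω) ^ t :=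
        ENNReal.lintegral_mul_norm_pow_le hGτ.aemeasurable hHτ.aemeasurable hs.le ht.le hst
    _ ≤ (C * ∏ i, recipNorm (a i) (G i)) ^ s * (D * ∏ i, recipNorm (b i) (H i)) ^ t := by
        gcongr
        · exact hCF G hG
        · exact hDF H hH
    _ = C ^ s * D ^ t * ∏ i, (recipNorm (a i) (G i) ^ s * recipNorm (b i) (H i) ^ t) := by
        rw [ENNReal.mul_rpow_of_nonneg _ _ hs.le, ENNReal.mul_rpow_of_nonneg _ _ ht.le,
          Finset.prod_mul_distrib, ENNReal.prod_rpow_of_nonneg hs.le,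
          ENNReal.prod_rpow_of_nonneg ht.le]
        ring
    _ ≤ C ^ s * D ^ t * ∏ i, recipNorm (c i) (F i) := by
        gcongr with i
        exact hN i

/-- The points `x`, `x - e(s)`, `x - e(s + α)` at which the three functions of the triangle form
are evaluated. -/
def triangleVertex (α : ℝ) (i : Fin 3) (z : ℝ × EuclideanSpace ℝ (Fin 2)) :
    EuclideanSpace ℝ (Fin 2) :=
  ![z.2, z.2 - circlePoint z.1, z.2 - circlePoint (z.1 + α)] i

lemma measurable_triangleVertex (α : ℝ) (i : Fin 3) : Measurable (triangleVertex α i) := by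
  unfold triangleVertex
  fin_cases i <;> simp <;> fun_prop

/-- The parameter space of unit equilateral triangles of a fixed orientation. -/
def triangleMeasure : Measure (ℝ × EuclideanSpace ℝ (Fin 2)) :=
  (volume.restrict (Set.Ico 0 (2 * π))).prod volume

lemma lintegral_triangleVertex (α : ℝ) {F : Fin 3 → EuclideanSpace ℝ (Fin 2) → ℝ≥0∞}
    (hF : ∀ i, Measurable (F i)) :
    ∫⁻ z, ∏ i, F i (triangleVertex α i z) ∂triangleMeasure =
      ∫⁻ s in Set.Ico 0 (2 * π), ∫⁻ x,
        F 0 x * (F 1 (x - circlePoint s) * F 2 (x - circlePoint (s + α))) := by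
  have hm : Measurable fun z => ∏ i, F i (triangleVertex α i z) :=
    Finset.measurable_prod _ fun i _ => (hF i).comp (measurable_triangleVertex α i)
  rw [triangleMeasure, lintegral_prod _ hm.aemeasurable]
  simp [Fin.prod_univ_three, triangleVertex, mul_assoc]

lemma triangleForm_le {f g h : EuclideanSpace ℝ (Fin 2) → ℝ≥0}
    (hf : Measurable f) (hg : Measurable g) (hh : Measurable h) :
    triangleForm f g h ≤
      ∫⁻ z, ∏ i, ![fun x => (f x : ℝ≥0∞), fun x => (g x : ℝ≥0∞), fun x => (h x : ℝ≥0∞)] i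
        (triangleVertex (π / 3) i z) ∂triangleMeasure +
      ∫⁻ z, ∏ i, ![fun x => (f x : ℝ≥0∞), fun x => (g x : ℝ≥0∞), fun x => (h x : ℝ≥0∞)] i
        (triangleVertex (-(π / 3)) i z) ∂triangleMeasure := by
  have hF : ∀ i, Measurable
      (![fun x => (f x : ℝ≥0∞), fun x => (g x : ℝ≥0∞), fun x => (h x : ℝ≥0∞)] i) := by
    intro i
    fin_cases i <;> simp <;> fun_prop
  have hB : ∀ θ x, Brot θ g h x ≤ ∫⁻ s in Set.Ico 0 (2 * π),
      (g (x - circlePoint s) : ℝ≥0∞) * h (x - circlePoint (s + θ)) := by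
    intro θ x
    refine (lintegral_mono' circleMeasure_le le_rfl).trans (le_of_eq ?_)
    rw [lintegral_map (by fun_prop) (by fun_prop)]
    simp_rw [rot_circlePoint]
  have hswap : ∀ θ, ∫⁻ z, ∏ i, ![fun x => (f x : ℝ≥0∞), fun x => (g x : ℝ≥0∞),
        fun x => (h x : ℝ≥0∞)] i (triangleVertex θ i z) ∂triangleMeasure =
      ∫⁻ x, (f x : ℝ≥0∞) * ∫⁻ s in Set.Ico 0 (2 * π),
        (g (x - circlePoint s) : ℝ≥0∞) * h (x - circlePoint (s + θ)) := by
    intro θ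
    rw [lintegral_triangleVertex θ hF]
    simp only [Matrix.cons_val]
    rw [lintegral_lintegral_swap (by fun_prop)]
    exact lintegral_congr fun x => lintegral_const_mul _ (by fun_prop)
  rw [hswap, hswap, ← lintegral_add_left (by fun_prop)]
  refine lintegral_mono fun x => ?_
  rw [← mul_add]
  gcongr <;> exact hB _ x

lemma ae_sub_le_recipNorm_zero (F : EuclideanSpace ℝ (Fin 2) → ℝ≥0∞)
    (y : EuclideanSpace ℝ (Fin 2)) : ∀ᵐ x, F (x - y) ≤ recipNorm 0 F := by
  rw [recipNorm_zero]
  exact (measurePreserving_sub_right volume y).quasiMeasurePreserving.ae (ENNReal.ae_le_essSup F)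

/-- A bound for fixed `s` of the inner integral gives membership after integrating in `s`. -/
lemma mem_boundedExponents_of_le {α : ℝ} {a : Fin 3 → ℝ} (ha : ∀ i, 0 ≤ a i) (C : ℕ)
    (h : ∀ F : Fin 3 → EuclideanSpace ℝ (Fin 2) → ℝ≥0∞, (∀ i, Measurable (F i)) →
      ∫⁻ s in Set.Ico 0 (2 * π), ∫⁻ x,
        F 0 x * (F 1 (x - circlePoint s) * F 2 (x - circlePoint (s + α))) ≤
      C * (recipNorm (a 0) (F 0) * (recipNorm (a 1) (F 1) * recipNorm (a 2) (F 2)))) :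
    a ∈ boundedExponents triangleMeasure (triangleVertex α) := by
  refine ⟨ha, C, ENNReal.natCast_ne_top C, fun F hF => ?_⟩
  rw [lintegral_triangleVertex α hF, Fin.prod_univ_three, mul_assoc (recipNorm _ _)]
  exact h F hF

lemma setLIntegral_Ico_const_le (K : ℝ≥0∞) :
    ∫⁻ _ in Set.Ico 0 (2 * π), K ≤ (7 : ℕ) * K := by
  refine lintegral_circle_le_of_arc one_pos (by push_cast; linarith [Real.pi_lt_d2]) fun b => ?_
  simp

section Vertices

variable (α : ℝ)

lemma mem_boundedExponents_one_zero_zero :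
    ![1, 0, 0] ∈ boundedExponents triangleMeasure (triangleVertex α) := by
  refine mem_boundedExponents_of_le (fun i => by fin_cases i <;> simp) 7 fun F hF => ?_
  refine le_trans (lintegral_mono fun s => ?_) (setLIntegral_Ico_const_le _)
  simp only [Matrix.cons_val]
  rw [recipNorm_of_pos one_pos]
  simp only [inv_one, ENNReal.rpow_one]
  rw [← lintegral_mul_const _ (hF 0)]
  refine lintegral_mono_ae ?_
  filter_upwards [ae_sub_le_recipNorm_zero (F 1) (circlePoint s),
    ae_sub_le_recipNorm_zero (F 2) (circlePoint (s + α))] with x h1 h2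
  gcongr

lemma mem_boundedExponents_zero_one_zero :
    ![0, 1, 0] ∈ boundedExponents triangleMeasure (triangleVertex α) := by
  refine mem_boundedExponents_of_le (fun i => by fin_cases i <;> simp) 7 fun F hF => ?_
  refine le_trans (lintegral_mono fun s => ?_) (setLIntegral_Ico_const_le _)
  simp only [Matrix.cons_val]
  rw [recipNorm_of_pos one_pos]
  simp only [inv_one, ENNReal.rpow_one]
  rw [← lintegral_sub_right_eq_self (F 1) (circlePoint s),
    ← lintegral_mul_const _ (by fun_prop), ← lintegral_const_mul _ (by fun_prop)]
  refine lintegral_mono_ae ?_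
  filter_upwards [ae_sub_le_recipNorm_zero (F 0) 0,
    ae_sub_le_recipNorm_zero (F 2) (circlePoint (s + α))] with x h1 h2
  rw [sub_zero] at h1
  gcongr

lemma mem_boundedExponents_zero_zero_one :
    ![0, 0, 1] ∈ boundedExponents triangleMeasure (triangleVertex α) := by
  refine mem_boundedExponents_of_le (fun i => by fin_cases i <;> simp) 7 fun F hF => ?_
  refine le_trans (lintegral_mono fun s => ?_) (setLIntegral_Ico_const_le _)
  simp only [Matrix.cons_val]
  rw [recipNorm_of_pos one_pos]
  simp only [inv_one, ENNReal.rpow_one]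
  rw [← lintegral_sub_right_eq_self (F 2) (circlePoint (s + α)),
    ← lintegral_const_mul _ (by fun_prop), ← lintegral_const_mul _ (by fun_prop)]
  refine lintegral_mono_ae ?_
  filter_upwards [ae_sub_le_recipNorm_zero (F 0) 0,
    ae_sub_le_recipNorm_zero (F 1) (circlePoint s)] with x h1 h2
  rw [sub_zero] at h1
  gcongr

lemma lintegral_circle_average_le_recipNorm (β : ℝ) {f g : EuclideanSpace ℝ (Fin 2) → ℝ≥0∞}
    (hf : Measurable f) (hg : Measurable g) :
    ∫⁻ s in Set.Ico 0 (2 * π), ∫⁻ x, f x * g (x - circlePoint (s + β)) ≤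
      (63 : ℕ) * (recipNorm (2 / 3) f * recipNorm (2 / 3) g) := by
  rw [recipNorm_of_pos (by norm_num), recipNorm_of_pos (by norm_num)]
  simpa using lintegral_circle_average_le β hf hg

lemma mem_boundedExponents_two_thirds_two_thirds_zero :
    ![2 / 3, 2 / 3, 0] ∈ boundedExponents triangleMeasure (triangleVertex α) := by
  refine mem_boundedExponents_of_le (fun i => by fin_cases i <;> norm_num) 63 fun F hF => ?_
  simp only [Matrix.cons_val]
  calc _ ≤ ∫⁻ s in Set.Ico 0 (2 * π),
        (∫⁻ x, F 0 x * F 1 (x - circlePoint (s + 0))) * recipNorm 0 (F 2) := by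
        refine lintegral_mono fun s => ?_
        rw [← lintegral_mul_const _ (by fun_prop)]
        refine lintegral_mono_ae ?_
        filter_upwards [ae_sub_le_recipNorm_zero (F 2) (circlePoint (s + α))] with x hx
        rw [add_zero, mul_assoc]
        gcongr
    _ = (∫⁻ s in Set.Ico 0 (2 * π), ∫⁻ x, F 0 x * F 1 (x - circlePoint (s + 0))) *
        recipNorm 0 (F 2) := lintegral_mul_const _ (by fun_prop)
    _ ≤ (63 : ℕ) * (recipNorm (2 / 3) (F 0) * recipNorm (2 / 3) (F 1)) * recipNorm 0 (F 2) := by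
        gcongr
        exact lintegral_circle_average_le_recipNorm 0 (hF 0) (hF 1)
    _ = _ := by ring

lemma mem_boundedExponents_two_thirds_zero_two_thirds :
    ![2 / 3, 0, 2 / 3] ∈ boundedExponents triangleMeasure (triangleVertex α) := by
  refine mem_boundedExponents_of_le (fun i => by fin_cases i <;> norm_num) 63 fun F hF => ?_
  simp only [Matrix.cons_val]
  calc _ ≤ ∫⁻ s in Set.Ico 0 (2 * π),
        recipNorm 0 (F 1) * ∫⁻ x, F 0 x * F 2 (x - circlePoint (s + α)) := by
        refine lintegral_mono fun s => ?_
        rw [← lintegral_const_mul _ (by fun_prop)]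
        refine lintegral_mono_ae ?_
        filter_upwards [ae_sub_le_recipNorm_zero (F 1) (circlePoint s)] with x hx
        rw [mul_left_comm]
        gcongr
    _ = recipNorm 0 (F 1) *
        ∫⁻ s in Set.Ico 0 (2 * π), ∫⁻ x, F 0 x * F 2 (x - circlePoint (s + α)) :=
        lintegral_const_mul _ (by fun_prop)
    _ ≤ recipNorm 0 (F 1) *
        ((63 : ℕ) * (recipNorm (2 / 3) (F 0) * recipNorm (2 / 3) (F 2))) := by
        gcongr
        exact lintegral_circle_average_le_recipNorm α (hF 0) (hF 2)
    _ = _ := by ring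

lemma mem_boundedExponents_zero_two_thirds_two_thirds {α : ℝ} (hα : Real.cos α = 1 / 2) :
    ![0, 2 / 3, 2 / 3] ∈ boundedExponents triangleMeasure (triangleVertex α) := by
  have hdiff : ∀ s, circlePoint (s + α) = circlePoint s + circlePoint (s + 2 * α) := by
    intro s
    have hs := Real.sin_sq_add_cos_sq α
    rw [hα] at hs
    ext i
    fin_cases i
    · simp only [circlePoint, Real.cos_add, Real.cos_two_mul, Real.sin_two_mul, hα,
        Fin.zero_eta, PiLp.add_apply, PiLp.toLp_apply, Matrix.cons_val_zero]
      ring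
    · simp only [circlePoint, Real.sin_add, Real.cos_two_mul, Real.sin_two_mul, hα,
        Fin.mk_one, PiLp.add_apply, PiLp.toLp_apply, Matrix.cons_val_one,
        Matrix.cons_val_fin_one]
      ring
  refine mem_boundedExponents_of_le (fun i => by fin_cases i <;> norm_num) 63 fun F hF => ?_
  simp only [Matrix.cons_val]
  calc _ ≤ ∫⁻ s in Set.Ico 0 (2 * π),
        recipNorm 0 (F 0) * ∫⁻ x, F 1 x * F 2 (x - circlePoint (s + 2 * α)) := by
        refine lintegral_mono fun s => ?_
        rw [← lintegral_sub_right_eq_self (fun x => F 1 x * F 2 (x - circlePoint (s + 2 * α)))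
          (circlePoint s), ← lintegral_const_mul _ (by fun_prop)]
        refine lintegral_mono_ae ?_
        filter_upwards [ae_sub_le_recipNorm_zero (F 0) 0] with x hx
        rw [sub_zero] at hx
        rw [hdiff, ← sub_sub]
        gcongr
    _ = recipNorm 0 (F 0) *
        ∫⁻ s in Set.Ico 0 (2 * π), ∫⁻ x, F 1 x * F 2 (x - circlePoint (s + 2 * α)) :=
        lintegral_const_mul _ (by fun_prop)
    _ ≤ recipNorm 0 (F 0) *
        ((63 : ℕ) * (recipNorm (2 / 3) (F 1) * recipNorm (2 / 3) (F 2))) := by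
        gcongr
        exact lintegral_circle_average_le_recipNorm (2 * α) (hF 1) (hF 2)
    _ = _ := by ring

lemma mem_boundedExponents_half_half_half {α : ℝ} (hα : α = π / 3 ∨ α = -(π / 3)) :
    ![1 / 2, 1 / 2, 1 / 2] ∈ boundedExponents triangleMeasure (triangleVertex α) := by
  refine mem_boundedExponents_of_le (fun i => by fin_cases i <;> norm_num) 26 fun F hF => ?_
  simp only [Matrix.cons_val]
  rw [recipNorm_of_pos one_half_pos, recipNorm_of_pos one_half_pos,
    recipNorm_of_pos one_half_pos, one_div, inv_inv, ← one_div]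
  rcases hα with rfl | rfl
  · have := lintegral_circle_transversal_le (β := π / 3) (γ := 0) (by ring) (hF 0) (hF 2) (hF 1)
    simp only [add_zero, mul_comm (F 2 _)] at this
    rw [mul_comm ((∫⁻ x, F 1 x ^ (2 : ℝ)) ^ (1 / 2 : ℝ))]
    exact_mod_cast this
  · have := lintegral_circle_transversal_le (β := 0) (γ := -(π / 3)) (by ring) (hF 0) (hF 1) (hF 2)
    simpa only [add_zero, Nat.cast_ofNat] using this

lemma convexHull_subset_boundedExponents {α : ℝ} (hα : α = π / 3 ∨ α = -(π / 3)) :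
    convexHull ℝ ({![1,0,0], ![0,1,0], ![0,0,1], ![2/3,2/3,0], ![2/3,0,2/3], ![0,2/3,2/3],
      ![1/2,1/2,1/2]} : Set (Fin 3 → ℝ)) ⊆
      boundedExponents triangleMeasure (triangleVertex α) := by
  have hcos : Real.cos α = 1 / 2 := by rcases hα with rfl | rfl <;> simp
  refine convexHull_min ?_ (convex_boundedExponents (measurable_triangleVertex α))
  rintro a (rfl | rfl | rfl | rfl | rfl | rfl | rfl)
  · exact mem_boundedExponents_one_zero_zero α
  · exact mem_boundedExponents_zero_one_zero α
  · exact mem_boundedExponents_zero_zero_one α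
  · exact mem_boundedExponents_two_thirds_two_thirds_zero α
  · exact mem_boundedExponents_two_thirds_zero_two_thirds α
  · exact mem_boundedExponents_zero_two_thirds_two_thirds hcos
  · exact mem_boundedExponents_half_half_half hα

end Vertices

/-- The strong type bound holds on the whole polytope, the vertex `(1/2,1/2,1/2)` included. -/
lemma exists_triangleForm_le_of_mem_convexHull {a : Fin 3 → ℝ}
    (ha : a ∈ convexHull ℝ ({![1,0,0], ![0,1,0], ![0,0,1], ![2/3,2/3,0], ![2/3,0,2/3],
      ![0,2/3,2/3], ![1/2,1/2,1/2]} : Set (Fin 3 → ℝ))) :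
    ∃ C : ℝ, 0 < C ∧ ∀ f g h : EuclideanSpace ℝ (Fin 2) → ℝ≥0,
      Measurable f → Measurable g → Measurable h →
      triangleForm f g h ≤ ENNReal.ofReal C *
        (nnLpNorm' (ENNReal.ofReal (a 0))⁻¹ f * (nnLpNorm' (ENNReal.ofReal (a 1))⁻¹ g *
          nnLpNorm' (ENNReal.ofReal (a 2))⁻¹ h)) := by
  obtain ⟨-, C, hC, hCF⟩ := convexHull_subset_boundedExponents (Or.inl rfl) ha
  obtain ⟨-, D, hD, hDF⟩ := convexHull_subset_boundedExponents (Or.inr rfl) ha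
  refine ⟨(C + D).toReal + 1, by positivity, fun f g h hf hg hh => ?_⟩
  have hF : ∀ i, Measurable
      (![fun x => (f x : ℝ≥0∞), fun x => (g x : ℝ≥0∞), fun x => (h x : ℝ≥0∞)] i) := by
    intro i
    fin_cases i <;> simp <;> fun_prop
  have hle : C + D ≤ ENNReal.ofReal ((C + D).toReal + 1) := by
    rw [← ENNReal.ofReal_toReal (ENNReal.add_ne_top.2 ⟨hC, hD⟩)]
    exact ENNReal.ofReal_le_ofReal (by simp)
  refine (triangleForm_le hf hg hh).trans ((add_le_add (hCF _ hF) (hDF _ hF)).trans ?_)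
  rw [← add_mul]
  simp only [nnLpNorm_eq_recipNorm, Fin.prod_univ_three, Matrix.cons_val, mul_assoc]
  gcongr

lemma nnLpNorm_half_indicator {E : Set (EuclideanSpace ℝ (Fin 2))} (hE : MeasurableSet E) :
    nnLpNorm' (ENNReal.ofReal (1 / 2))⁻¹ (E.indicator fun _ => 1) =
      volume E ^ (1 / 2 : ℝ) := by
  rw [nnLpNorm_eq_recipNorm, recipNorm_of_pos one_half_pos, ← lintegral_indicator_one hE]
  congr 2 with x
  by_cases hx : x ∈ E <;> simp [hx]

/-- **Theorem (triangle).** The trilinear form attached to the complete graph on three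
vertices is bounded on `L^{1/a₁} × L^{1/a₂} × L^{1/a₃}` for every `(a₁,a₂,a₃)` in the
polytope `P` with vertices `(1,0,0)`, `(0,1,0)`, `(0,0,1)`, `(2/3,2/3,0)`, `(2/3,0,2/3)`,
`(0,2/3,2/3)`, `(1/2,1/2,1/2)`, except possibly at the vertex `(1/2,1/2,1/2)`, where a
restricted strong type estimate holds. -/
theorem triangle_form_bounds :
    (∀ a : Fin 3 → ℝ,
      a ∈ convexHull ℝ
        ({![1,0,0], ![0,1,0], ![0,0,1], ![2/3,2/3,0], ![2/3,0,2/3], ![0,2/3,2/3],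
          ![1/2,1/2,1/2]} : Set (Fin 3 → ℝ)) →
      a ≠ ![1/2,1/2,1/2] →
      ∃ C : ℝ, 0 < C ∧
        ∀ f g h : EuclideanSpace ℝ (Fin 2) → ℝ≥0,
          Measurable f → Measurable g → Measurable h →
          triangleForm f g h ≤ ENNReal.ofReal C *
            (nnLpNorm' (ENNReal.ofReal (a 0))⁻¹ f * (nnLpNorm' (ENNReal.ofReal (a 1))⁻¹ g *
              nnLpNorm' (ENNReal.ofReal (a 2))⁻¹ h))) ∧
    (∃ C : ℝ, 0 < C ∧
      ∀ E₁ E₂ E₃ : Set (EuclideanSpace ℝ (Fin 2)),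
        MeasurableSet E₁ → MeasurableSet E₂ → MeasurableSet E₃ →
        volume E₁ < ⊤ → volume E₂ < ⊤ → volume E₃ < ⊤ →
        triangleForm (E₁.indicator fun _ => 1) (E₂.indicator fun _ => 1)
            (E₃.indicator fun _ => 1) ≤
          ENNReal.ofReal C * (volume E₁ * volume E₂ * volume E₃) ^ (1/2 : ℝ)) := by
  refine ⟨fun a ha _ => exists_triangleForm_le_of_mem_convexHull ha, ?_⟩
  obtain ⟨C, hC, hCF⟩ := exists_triangleForm_le_of_mem_convexHull
    (a := ![1/2,1/2,1/2]) (subset_convexHull ℝ _ (by simp))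
  refine ⟨C, hC, fun E₁ E₂ E₃ h₁ h₂ h₃ _ _ _ => ?_⟩
  refine (hCF _ _ _ (measurable_const.indicator h₁) (measurable_const.indicator h₂)
    (measurable_const.indicator h₃)).trans (le_of_eq ?_)
  simp only [Matrix.cons_val]
  rw [nnLpNorm_half_indicator h₁, nnLpNorm_half_indicator h₂, nnLpNorm_half_indicator h₃,
    ENNReal.mul_rpow_of_nonneg _ _ one_half_pos.le,
    ENNReal.mul_rpow_of_nonneg _ _ one_half_pos.le, mul_assoc (volume E₁ ^ _)]
end
end

section
/- Let d ≥ 2, let σ be the surface measure on the unit sphere S^{d−1} ⊂ ℝ^d, let Af(x) = ∫_{S^{d−1}} f(x−ω) dσ(ω), and let p₁,p₂,p₃ ∈ [1,∞]. Suppose there is a constant C such that ∫_{ℝ^d} Af(x) Ag(x) h(x) dx ≤ C ‖f‖_{L^{p₁}(ℝ^d)} ‖g‖_{L^{p₂}(ℝ^d)} ‖h‖_{L^{p₃}(ℝ^d)} for all nonnegative measurable f,g,h : ℝ^d → [0,∞). Then: (1) 1/p₁ + 1/p₂ + 1/p₃ ≥ 1; (2) 1/p₁ + 1/p₂ + d/p₃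 ≤ d; (3) d/p₁ + d/p₂ + 1/p₃ ≤ 2d−1; (4) d/p₁ + 1/p₃ ≤ d; (5) d/p₂ + 1/p₃ ≤ d. -/
open MeasureTheory ENNReal NNReal

noncomputable section

/-- The surface measure on the unit sphere `S^{d-1} ⊂ ℝ^d`: the `(d−1)`-dimensional
Hausdorff measure restricted to the unit sphere. -/
def sphereMeasure (d : ℕ) : Measure (EuclideanSpace ℝ (Fin d)) :=
  (MeasureTheory.Measure.hausdorffMeasure ((d : ℝ) - 1)).restrict
    (Metric.sphere (0 : EuclideanSpace ℝ (Fin d)) 1)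

/-- The spherical averaging operator `Af(x) = ∫_{S^{d-1}} f(x−ω) dσ(ω)`. -/
def sphereAvg (d : ℕ) (f : EuclideanSpace ℝ (Fin d) → ℝ≥0)
    (x : EuclideanSpace ℝ (Fin d)) : ℝ≥0∞ :=
  ∫⁻ ω, (f (x - ω) : ℝ≥0∞) ∂(sphereMeasure d)

/-- A spherical cap of radius `r ≤ 1` in `S^n` has surface measure at least `c r ^ n`. -/
lemma exists_le_sphereMeasure_closedBall (n : ℕ) :
    ∃ c : ℝ≥0∞, c ≠ 0 ∧ ∀ r : ℝ, 0 < r → r ≤ 1 →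
      ∀ w : EuclideanSpace ℝ (Fin (n + 1)), ‖w‖ = 1 →
        c * ENNReal.ofReal r ^ (n : ℝ) ≤ sphereMeasure (n + 1) (Metric.closedBall w r) := by
  have hHaar : (Measure.hausdorffMeasure (n : ℝ) :
      Measure (EuclideanSpace ℝ (Fin n))).IsAddHaarMeasure := by
    simpa using MeasureTheory.isAddHaarMeasure_hausdorffMeasure (E := EuclideanSpace ℝ (Fin n))
  refine ⟨ENNReal.ofReal (2⁻¹ ^ n) * Measure.hausdorffMeasure (n : ℝ)
    (Metric.ball (0 : EuclideanSpace ℝ (Fin n)) 1), ?_, ?_⟩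
  · exact mul_ne_zero (by rw [Ne, ENNReal.ofReal_eq_zero, not_le]; positivity)
      (Metric.measure_ball_pos _ _ one_pos).ne'
  intro r hr hr1 w hw
  have hw0 : w ≠ 0 := by rintro rfl; simp at hw
  have : Fact (Module.finrank ℝ (EuclideanSpace ℝ (Fin (n + 1))) = n + 1) := ⟨by simp⟩
  let b := OrthonormalBasis.fromOrthogonalSpanSingleton (𝕜 := ℝ) n hw0
  let f : EuclideanSpace ℝ (Fin (n + 1)) → EuclideanSpace ℝ (Fin n) :=
    fun x => b.repr ((ℝ ∙ w)ᗮ.orthogonalProjectionOnto x)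
  have hf : LipschitzWith 1 f := by
    have h := b.repr.isometry.lipschitz.comp (ℝ ∙ w)ᗮ.lipschitzWith_orthogonalProjectionOnto
    rwa [one_mul] at h
  have hsub : Metric.ball (0 : EuclideanSpace ℝ (Fin n)) (r / 2) ⊆
      f '' (Metric.closedBall w r ∩ Metric.sphere 0 1) := by
    intro y hy
    obtain ⟨v, rfl⟩ := b.repr.surjective y
    have hv : ‖v‖ < r / 2 := by simpa using hy
    have hv0 := norm_nonneg v
    have hs : 0 ≤ 1 - ‖v‖ ^ 2 := by nlinarith
    have hs2 := Real.sq_sqrt hs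
    have hs0 := Real.sqrt_nonneg (1 - ‖v‖ ^ 2)
    set s := √(1 - ‖v‖ ^ 2) with hsdef
    have hs1 : s ≤ 1 := by nlinarith [sq_nonneg ‖v‖]
    have hin : inner ℝ w (v : EuclideanSpace ℝ (Fin (n + 1))) = 0 :=
      Submodule.mem_orthogonal_singleton_iff_inner_right.1 v.2
    have hnorm : ∀ t : ℝ, ‖t • w + (v : EuclideanSpace ℝ (Fin (n + 1)))‖ ^ 2
        = t ^ 2 + ‖v‖ ^ 2 := by
      intro t
      rw [norm_add_sq_real, inner_smul_left, hin, norm_smul, hw]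
      simp
    refine ⟨s • w + v, ⟨?_, ?_⟩, ?_⟩
    · rw [Metric.mem_closedBall, dist_eq_norm]
      have : s • w + (v : EuclideanSpace ℝ (Fin (n + 1))) - w = (s - 1) • w + v := by
        rw [sub_smul, one_smul]; abel
      rw [this]
      refine le_of_sq_le_sq ?_ hr.le
      rw [hnorm]
      nlinarith
    · rw [mem_sphere_zero_iff_norm]
      have := hnorm s
      rw [hs2, sub_add_cancel] at this
      exact (pow_eq_one_iff_of_nonneg (norm_nonneg _) two_ne_zero).1 this
    · have h1 : (ℝ ∙ w)ᗮ.orthogonalProjectionOnto w = 0 :=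
        Submodule.orthogonalProjectionOnto_orthogonalComplement_singleton_eq_zero w
      simp [f, h1]
  have hmeas : sphereMeasure (n + 1) (Metric.closedBall w r) =
      Measure.hausdorffMeasure (n : ℝ) (Metric.closedBall w r ∩ Metric.sphere 0 1) := by
    rw [sphereMeasure, Measure.restrict_apply Metric.isClosed_closedBall.measurableSet]
    simp
  rw [hmeas]
  calc _ = Measure.hausdorffMeasure (n : ℝ)
        (Metric.ball (0 : EuclideanSpace ℝ (Fin n)) (r / 2)) := by
        rw [Measure.addHaar_ball_of_pos _ _ (half_pos hr), finrank_euclideanSpace_fin,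
          ENNReal.rpow_natCast, ← ENNReal.ofReal_pow hr.le, mul_right_comm,
          ← ENNReal.ofReal_mul (by positivity), ← mul_pow]
        congr 3; ring
    _ ≤ _ := (measure_mono hsub).trans (by
        simpa using hf.hausdorffMeasure_image_le (Nat.cast_nonneg n)
          (Metric.closedBall w r ∩ Metric.sphere 0 1))

/-- If `A t ^ a ≤ B t ^ b` as `t → 0` then `b ≤ a`. -/
lemma le_of_mul_rpow_le_mul_rpow {A B : ℝ≥0∞} (hA : A ≠ 0) (hB : B ≠ ∞) {a b : ℝ}
    (h : ∀ t : ℝ, 0 < t → t ≤ 1 / 2 →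
      A * ENNReal.ofReal t ^ a ≤ B * ENNReal.ofReal t ^ b) : b ≤ a := by
  by_contra! hab
  have hle : ∀ t : ℝ, 0 < t → t ≤ 1 / 2 → A ≤ B * ENNReal.ofReal t ^ (b - a) := by
    intro t ht ht2
    have h0 : ENNReal.ofReal t ≠ 0 := by simpa using ht
    have := mul_le_mul_left (h t ht ht2) (ENNReal.ofReal t ^ (-a))
    rwa [mul_assoc, mul_assoc, ← ENNReal.rpow_add _ _ h0 ENNReal.ofReal_ne_top,
      ← ENNReal.rpow_add _ _ h0 ENNReal.ofReal_ne_top, add_neg_cancel, ENNReal.rpow_zero,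
      mul_one, ← sub_eq_add_neg] at this
  have hlim : Filter.Tendsto (fun t : ℝ => B * ENNReal.ofReal t ^ (b - a))
      (nhdsWithin 0 (Set.Ioi 0)) (nhds 0) := by
    have h1 : Filter.Tendsto (fun t : ℝ => ENNReal.ofReal t ^ (b - a)) (nhds 0) (nhds 0) := by
      have := ((ENNReal.continuous_rpow_const (y := b - a)).comp
        ENNReal.continuous_ofReal).tendsto 0
      simpa [Function.comp_def, ENNReal.zero_rpow_of_pos (sub_pos.2 hab)] using this
    have h2 := ENNReal.Tendsto.const_mul (h1.mono_left (nhdsWithin_le_nhds (s := Set.Ioi 0)))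
      (Or.inr hB)
    rwa [mul_zero] at h2
  refine hA (le_zero_iff.1 (ge_of_tendsto hlim ?_))
  filter_upwards [Ioc_mem_nhdsGT (show (0 : ℝ) < 1 / 2 by norm_num)] with t ht
  exact hle t ht.1 ht.2

/-- The trilinear estimate of `chain_form_necessary_conditions`. -/
def ChainBound (d : ℕ) (p₁ p₂ p₃ : ℝ≥0∞) (C : ℝ) : Prop :=
  ∀ f g h : EuclideanSpace ℝ (Fin d) → ℝ≥0,
    Measurable f → Measurable g → Measurable h →
    (∫⁻ x, sphereAvg d f x * sphereAvg d g x * (h x : ℝ≥0∞)) ≤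
      ENNReal.ofReal C * (nnLpNorm' p₁ f * (nnLpNorm' p₂ g * nnLpNorm' p₃ h))

lemma nnLpNorm'_indicator_le {d : ℕ} (p : ℝ≥0∞) (s : Set (EuclideanSpace ℝ (Fin d))) :
    nnLpNorm' p (s.indicator 1) ≤ volume s ^ (p⁻¹).toReal := by
  have h : (fun x => ((s.indicator 1 x : ℝ≥0) : ℝ)) = s.indicator fun _ => (1 : ℝ) := by
    ext x; by_cases hx : x ∈ s <;> simp [hx]
  rw [nnLpNorm', h]
  simpa using eLpNorm_indicator_const_le (μ := volume) (s := s) (c := (1 : ℝ)) p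

lemma sphereAvg_indicator {d : ℕ} {s : Set (EuclideanSpace ℝ (Fin d))} (hs : MeasurableSet s)
    (x : EuclideanSpace ℝ (Fin d)) :
    sphereAvg d (s.indicator 1) x = sphereMeasure d {w | x - w ∈ s} := by
  have hm : MeasurableSet {w | x - w ∈ s} := (measurable_const.sub measurable_id) hs
  rw [sphereAvg, ← lintegral_indicator_one hm]
  congr 1; ext w
  by_cases hx : x - w ∈ s <;> simp [hx]

/-- The trilinear estimate tested on indicator functions. -/
lemma ChainBound.indicator {d : ℕ} {p₁ p₂ p₃ : ℝ≥0∞} {C : ℝ} (H : ChainBound d p₁ p₂ p₃ C)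
    {s₁ s₂ s₃ : Set (EuclideanSpace ℝ (Fin d))}
    (h₁ : MeasurableSet s₁) (h₂ : MeasurableSet s₂) (h₃ : MeasurableSet s₃) {a b : ℝ≥0∞}
    (ha : ∀ x ∈ s₃, a ≤ sphereMeasure d {w | x - w ∈ s₁})
    (hb : ∀ x ∈ s₃, b ≤ sphereMeasure d {w | x - w ∈ s₂}) :
    a * b * volume s₃ ≤ ENNReal.ofReal C * (volume s₁ ^ (p₁⁻¹).toReal *
      (volume s₂ ^ (p₂⁻¹).toReal * volume s₃ ^ (p₃⁻¹).toReal)) := by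
  calc a * b * volume s₃ = ∫⁻ x, s₃.indicator (fun _ => a * b) x :=
        (lintegral_indicator_const h₃ _).symm
    _ ≤ ∫⁻ x, sphereAvg d (s₁.indicator 1) x * sphereAvg d (s₂.indicator 1) x *
          ((s₃.indicator 1 x : ℝ≥0) : ℝ≥0∞) := by
        refine lintegral_mono fun x => ?_
        by_cases hx : x ∈ s₃
        · simpa [hx, sphereAvg_indicator h₁, sphereAvg_indicator h₂] using
            mul_le_mul' (ha x hx) (hb x hx)
        · simp [hx]
    _ ≤ _ := H _ _ _ (measurable_one.indicator h₁) (measurable_one.indicator h₂)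
        (measurable_one.indicator h₃)
    _ ≤ _ := by gcongr <;> exact nnLpNorm'_indicator_le _ _

/-- Testing the trilinear estimate on families of sets whose sizes scale like powers of `t`. -/
lemma ChainBound.scaling {d : ℕ} {p₁ p₂ p₃ : ℝ≥0∞} {C : ℝ} (H : ChainBound d p₁ p₂ p₃ C)
    {s₁ s₂ s₃ : ℝ → Set (EuclideanSpace ℝ (Fin d))}
    (h₁ : ∀ t, MeasurableSet (s₁ t)) (h₂ : ∀ t, MeasurableSet (s₂ t))
    (h₃ : ∀ t, MeasurableSet (s₃ t)) {c₁ c₂ c₃ K₁ K₂ K₃ : ℝ≥0∞}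
    (hc₁ : c₁ ≠ 0) (hc₂ : c₂ ≠ 0) (hc₃ : c₃ ≠ 0) (hK₁ : K₁ ≠ ∞) (hK₂ : K₂ ≠ ∞) (hK₃ : K₃ ≠ ∞)
    (α₁ α₂ α₃ β₁ β₂ : ℝ)
    (ha : ∀ t, 0 < t → t ≤ 1 / 2 → ∀ x ∈ s₃ t,
      c₁ * ENNReal.ofReal t ^ α₁ ≤ sphereMeasure d {w | x - w ∈ s₁ t})
    (hb : ∀ t, 0 < t → t ≤ 1 / 2 → ∀ x ∈ s₃ t,
      c₂ * ENNReal.ofReal t ^ α₂ ≤ sphereMeasure d {w | x - w ∈ s₂ t})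
    (hc : ∀ t, 0 < t → t ≤ 1 / 2 → c₃ * ENNReal.ofReal t ^ α₃ ≤ volume (s₃ t))
    (hv₁ : ∀ t, 0 < t → t ≤ 1 / 2 → volume (s₁ t) ≤ K₁ * ENNReal.ofReal t ^ β₁)
    (hv₂ : ∀ t, 0 < t → t ≤ 1 / 2 → volume (s₂ t) ≤ K₂ * ENNReal.ofReal t ^ β₂)
    (hv₃ : ∀ t, 0 < t → t ≤ 1 / 2 → volume (s₃ t) ≤ K₃ * ENNReal.ofReal t ^ α₃) :
    β₁ * (p₁⁻¹).toReal + β₂ * (p₂⁻¹).toReal + α₃ * (p₃⁻¹).toReal ≤ α₁ + α₂ + α₃ := by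
  have hq₁ : 0 ≤ (p₁⁻¹).toReal := ENNReal.toReal_nonneg
  have hq₂ : 0 ≤ (p₂⁻¹).toReal := ENNReal.toReal_nonneg
  have hq₃ : 0 ≤ (p₃⁻¹).toReal := ENNReal.toReal_nonneg
  refine le_of_mul_rpow_le_mul_rpow (A := c₁ * c₂ * c₃)
    (B := ENNReal.ofReal C * (K₁ ^ (p₁⁻¹).toReal * (K₂ ^ (p₂⁻¹).toReal * K₃ ^ (p₃⁻¹).toReal)))
    (mul_ne_zero (mul_ne_zero hc₁ hc₂) hc₃) ?_ fun t ht ht2 => ?_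
  · exact ENNReal.mul_ne_top ENNReal.ofReal_ne_top (ENNReal.mul_ne_top
      (ENNReal.rpow_ne_top_of_nonneg hq₁ hK₁) (ENNReal.mul_ne_top
        (ENNReal.rpow_ne_top_of_nonneg hq₂ hK₂) (ENNReal.rpow_ne_top_of_nonneg hq₃ hK₃)))
  have h0 : ENNReal.ofReal t ≠ 0 := by simpa using ht
  calc _ = c₁ * ENNReal.ofReal t ^ α₁ * (c₂ * ENNReal.ofReal t ^ α₂) *
        (c₃ * ENNReal.ofReal t ^ α₃) := by
        rw [ENNReal.rpow_add _ _ h0 ENNReal.ofReal_ne_top,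
          ENNReal.rpow_add _ _ h0 ENNReal.ofReal_ne_top]
        ring
    _ ≤ c₁ * ENNReal.ofReal t ^ α₁ * (c₂ * ENNReal.ofReal t ^ α₂) * volume (s₃ t) := by
        gcongr; exact hc t ht ht2
    _ ≤ _ := H.indicator (h₁ t) (h₂ t) (h₃ t) (ha t ht ht2) (hb t ht ht2)
    _ ≤ ENNReal.ofReal C * ((K₁ * ENNReal.ofReal t ^ β₁) ^ (p₁⁻¹).toReal *
        ((K₂ * ENNReal.ofReal t ^ β₂) ^ (p₂⁻¹).toReal *
          (K₃ * ENNReal.ofReal t ^ α₃) ^ (p₃⁻¹).toReal)) := by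
        gcongr
        · exact hv₁ t ht ht2
        · exact hv₂ t ht ht2
        · exact hv₃ t ht ht2
    _ = _ := by
        rw [ENNReal.mul_rpow_of_nonneg _ _ hq₁, ENNReal.mul_rpow_of_nonneg _ _ hq₂,
          ENNReal.mul_rpow_of_nonneg _ _ hq₃, ← ENNReal.rpow_mul, ← ENNReal.rpow_mul,
          ← ENNReal.rpow_mul, ENNReal.rpow_add _ _ h0 ENNReal.ofReal_ne_top,
          ENNReal.rpow_add _ _ h0 ENNReal.ofReal_ne_top]
        ring

/-- The annulus of width `2t` around the unit sphere. -/
def annulus (d : ℕ) (t : ℝ) : Set (EuclideanSpace ℝ (Fin d)) :=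
  Metric.ball 0 (1 + t) \ Metric.ball 0 (1 - t)

lemma mem_annulus {d : ℕ} {t : ℝ} {x : EuclideanSpace ℝ (Fin d)} :
    x ∈ annulus d t ↔ ‖x‖ < 1 + t ∧ 1 - t ≤ ‖x‖ := by
  simp [annulus]

lemma measurableSet_annulus (d : ℕ) (t : ℝ) : MeasurableSet (annulus d t) :=
  measurableSet_ball.diff measurableSet_ball

lemma volume_annulus {d : ℕ} {t : ℝ} (ht : 0 < t) (ht2 : t ≤ 1 / 2) :
    volume (annulus d t) = ENNReal.ofReal ((1 + t) ^ d - (1 - t) ^ d) *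
      volume (Metric.ball (0 : EuclideanSpace ℝ (Fin d)) 1) := by
  rw [annulus, measure_sdiff (Metric.ball_subset_ball (by linarith))
    measurableSet_ball.nullMeasurableSet measure_ball_lt_top.ne,
    Measure.addHaar_ball_of_pos _ 0 (show 0 < 1 + t by linarith),
    Measure.addHaar_ball_of_pos _ 0 (show 0 < 1 - t by linarith),
    finrank_euclideanSpace_fin, ENNReal.ofReal_sub _ (pow_nonneg (by linarith) _),
    ENNReal.sub_mul fun _ _ => measure_ball_lt_top.ne]

lemma le_volume_annulus {d : ℕ} (hd : d ≠ 0) {t : ℝ} (ht : 0 < t) (ht2 : t ≤ 1 / 2) :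
    volume (Metric.ball (0 : EuclideanSpace ℝ (Fin d)) 1) * ENNReal.ofReal t ^ (1 : ℝ) ≤
      volume (annulus d t) := by
  rw [volume_annulus ht ht2, ENNReal.rpow_one, mul_comm]
  gcongr
  have h1 : 1 + t ≤ (1 + t) ^ d := le_self_pow₀ (by linarith) hd
  have h2 : (1 - t) ^ d ≤ 1 := pow_le_one₀ (by linarith) (by linarith)
  linarith

lemma volume_annulus_le {d : ℕ} {t : ℝ} (ht : 0 < t) (ht2 : t ≤ 1 / 2) :
    volume (annulus d t) ≤ ENNReal.ofReal (2 * d * 2 ^ (d - 1)) *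
      volume (Metric.ball (0 : EuclideanSpace ℝ (Fin d)) 1) * ENNReal.ofReal t ^ (1 : ℝ) := by
  rw [volume_annulus ht ht2, ENNReal.rpow_one, mul_right_comm,
    ← ENNReal.ofReal_mul (by positivity)]
  gcongr
  have h := (le_abs_self _).trans (abs_pow_sub_pow_le (1 + t) (1 - t) d)
  have hm : max |1 + t| |1 - t| ≤ 2 := by
    rw [abs_of_pos (by linarith), abs_of_pos (by linarith)]
    exact max_le (by linarith) (by linarith)
  have h2 : |1 + t - (1 - t)| = 2 * t := by
    rw [show 1 + t - (1 - t) = 2 * t by ring, abs_of_pos (by linarith)]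
  rw [h2] at h
  calc _ ≤ _ := h
    _ ≤ 2 * t * d * 2 ^ (d - 1) := by gcongr
    _ = _ := by ring

lemma volume_ball_mul {d : ℕ} {k t : ℝ} (hk : 0 < k) (ht : 0 < t) :
    volume (Metric.ball (0 : EuclideanSpace ℝ (Fin d)) (k * t)) =
      ENNReal.ofReal (k ^ d) * volume (Metric.ball (0 : EuclideanSpace ℝ (Fin d)) 1) *
        ENNReal.ofReal t ^ (d : ℝ) := by
  rw [Measure.addHaar_ball_of_pos _ _ (by positivity), finrank_euclideanSpace_fin,
    ENNReal.rpow_natCast, ← ENNReal.ofReal_pow ht.le, mul_right_comm,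
    ← ENNReal.ofReal_mul (by positivity), mul_pow]

lemma volume_ball_div {d : ℕ} {k t : ℝ} (hk : 0 < k) (ht : 0 < t) :
    volume (Metric.ball (0 : EuclideanSpace ℝ (Fin d)) (k / t)) =
      ENNReal.ofReal (k ^ d) * volume (Metric.ball (0 : EuclideanSpace ℝ (Fin d)) 1) *
        ENNReal.ofReal t ^ (-d : ℝ) := by
  rw [div_eq_mul_inv, volume_ball_mul hk (inv_pos.2 ht), ENNReal.ofReal_inv_of_pos ht,
    ENNReal.rpow_neg, ENNReal.inv_rpow]

/-- If `x - w ∈ s` for all unit vectors `w ∈ u`, then `u` has at most the surface measure of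
`{w | x - w ∈ s}`. -/
lemma sphereMeasure_le_of_forall {d : ℕ} {s u : Set (EuclideanSpace ℝ (Fin d))}
    {x : EuclideanSpace ℝ (Fin d)} (hu : MeasurableSet u)
    (h : ∀ w ∈ u, ‖w‖ = 1 → x - w ∈ s) :
    sphereMeasure d u ≤ sphereMeasure d {w | x - w ∈ s} := by
  rw [sphereMeasure, Measure.restrict_apply hu]
  refine (measure_mono ?_).trans (Measure.le_restrict_apply _ _)
  exact fun w hw => ⟨h w hw.1 (by simpa using hw.2), hw.2⟩

lemma le_sphereMeasure_of_mem_annulus {n : ℕ} {c : ℝ≥0∞}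
    (hc : ∀ r : ℝ, 0 < r → r ≤ 1 →
      ∀ w : EuclideanSpace ℝ (Fin (n + 1)), ‖w‖ = 1 →
        c * ENNReal.ofReal r ^ (n : ℝ) ≤ sphereMeasure (n + 1) (Metric.closedBall w r))
    {t : ℝ} (ht : 0 < t) (ht2 : t ≤ 1 / 2) {x : EuclideanSpace ℝ (Fin (n + 1))}
    (hx : x ∈ annulus (n + 1) t) :
    c * ENNReal.ofReal t ^ (n : ℝ) ≤
      sphereMeasure (n + 1) {w | x - w ∈ Metric.ball 0 (3 * t)} := by
  rw [mem_annulus] at hx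
  have hx0 : 0 < ‖x‖ := by linarith [hx.2]
  have hw : ‖‖x‖⁻¹ • x‖ = 1 := by
    rw [norm_smul, norm_inv, norm_norm, inv_mul_cancel₀ hx0.ne']
  refine (hc t ht (by linarith) _ hw).trans
    (sphereMeasure_le_of_forall Metric.isClosed_closedBall.measurableSet fun w hw' _ => ?_)
  rw [Metric.mem_closedBall, dist_comm, dist_eq_norm] at hw'
  have h1 : ‖x - ‖x‖⁻¹ • x‖ ≤ t := by
    have : x - ‖x‖⁻¹ • x = (‖x‖ - 1) • (‖x‖⁻¹ • x) := by
      rw [sub_smul, one_smul, smul_smul, mul_inv_cancel₀ hx0.ne', one_smul]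
    rw [this, norm_smul, hw, mul_one, Real.norm_eq_abs, abs_le]
    constructor <;> linarith [hx.1, hx.2]
  rw [mem_ball_zero_iff]
  linarith [norm_sub_le_norm_sub_add_norm_sub x (‖x‖⁻¹ • x) w]

lemma le_sphereMeasure_of_forall_norm_eq_one {n : ℕ} {c : ℝ≥0∞}
    (hc : ∀ r : ℝ, 0 < r → r ≤ 1 →
      ∀ w : EuclideanSpace ℝ (Fin (n + 1)), ‖w‖ = 1 →
        c * ENNReal.ofReal r ^ (n : ℝ) ≤ sphereMeasure (n + 1) (Metric.closedBall w r))
    (t : ℝ) {s : Set (EuclideanSpace ℝ (Fin (n + 1)))} {x : EuclideanSpace ℝ (Fin (n + 1))}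
    (h : ∀ w, ‖w‖ = 1 → x - w ∈ s) :
    c * ENNReal.ofReal t ^ (0 : ℝ) ≤ sphereMeasure (n + 1) {w | x - w ∈ s} := by
  have := hc 1 one_pos le_rfl (EuclideanSpace.single 0 1) (by simp)
  refine le_trans ?_ (this.trans (sphereMeasure_le_of_forall
    Metric.isClosed_closedBall.measurableSet fun w _ hw => h w hw))
  simp

lemma ChainBound.symm {d : ℕ} {p₁ p₂ p₃ : ℝ≥0∞} {C : ℝ} (H : ChainBound d p₁ p₂ p₃ C) :
    ChainBound d p₂ p₁ p₃ C := by
  intro f g h hf hg hh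
  have := H g f h hg hf hh
  rwa [mul_left_comm (nnLpNorm' p₁ g), lintegral_congr fun x =>
    congrArg (· * (h x : ℝ≥0∞)) (mul_comm (sphereAvg d g x) (sphereAvg d f x))] at this

/-- Testing on large balls. -/
lemma ChainBound.one_le {n : ℕ} {p₁ p₂ p₃ : ℝ≥0∞} {C : ℝ} (H : ChainBound (n + 1) p₁ p₂ p₃ C) :
    1 ≤ (p₁⁻¹).toReal + (p₂⁻¹).toReal + (p₃⁻¹).toReal := by
  obtain ⟨c, hc0, hc⟩ := exists_le_sphereMeasure_closedBall n
  have hV0 : volume (Metric.ball (0 : EuclideanSpace ℝ (Fin (n + 1))) 1) ≠ 0 :=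
    (Metric.measure_ball_pos _ _ one_pos).ne'
  have hVt : volume (Metric.ball (0 : EuclideanSpace ℝ (Fin (n + 1))) 1) ≠ ∞ :=
    measure_ball_lt_top.ne
  have hK : ∀ k : ℝ, ENNReal.ofReal (k ^ (n + 1)) *
      volume (Metric.ball (0 : EuclideanSpace ℝ (Fin (n + 1))) 1) ≠ ∞ :=
    fun k => ENNReal.mul_ne_top ENNReal.ofReal_ne_top hVt
  have hbig : ∀ t : ℝ, 0 < t → t ≤ 1 / 2 →
      ∀ x ∈ Metric.ball (0 : EuclideanSpace ℝ (Fin (n + 1))) (1 / t),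
      c * ENNReal.ofReal t ^ (0 : ℝ) ≤
        sphereMeasure (n + 1) {w | x - w ∈ Metric.ball 0 (2 / t)} := by
    intro t ht ht2 x hx
    refine le_sphereMeasure_of_forall_norm_eq_one hc t fun w hw => ?_
    rw [mem_ball_zero_iff] at hx ⊢
    have h1 : 1 ≤ 1 / t := by rw [le_div_iff₀ ht]; linarith
    have h2 : 2 / t = 1 / t + 1 / t := by ring
    linarith [norm_sub_le x w]
  have := H.scaling (s₁ := fun t => Metric.ball 0 (2 / t)) (s₂ := fun t => Metric.ball 0 (2 / t))
    (s₃ := fun t => Metric.ball 0 (1 / t))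
    (fun _ => measurableSet_ball) (fun _ => measurableSet_ball) (fun _ => measurableSet_ball)
    hc0 hc0 (c₃ := ENNReal.ofReal (1 ^ (n + 1)) *
      volume (Metric.ball (0 : EuclideanSpace ℝ (Fin (n + 1))) 1))
    (by simpa using hV0) (hK 2) (hK 2) (hK 1) 0 0 (-(n + 1 : ℕ)) (-(n + 1 : ℕ)) (-(n + 1 : ℕ))
    hbig hbig
    (fun t ht _ => (volume_ball_div one_pos ht).ge)
    (fun t ht _ => (volume_ball_div two_pos ht).le)
    (fun t ht _ => (volume_ball_div two_pos ht).le)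
    (fun t ht _ => (volume_ball_div one_pos ht).le)
  have hn : (0 : ℝ) < (n + 1 : ℕ) := by positivity
  nlinarith

/-- Testing on two annuli and a small ball. -/
lemma ChainBound.annulus_annulus_ball {n : ℕ} {p₁ p₂ p₃ : ℝ≥0∞} {C : ℝ}
    (H : ChainBound (n + 1) p₁ p₂ p₃ C) :
    (p₁⁻¹).toReal + (p₂⁻¹).toReal + (n + 1) * (p₃⁻¹).toReal ≤ n + 1 := by
  obtain ⟨c, hc0, hc⟩ := exists_le_sphereMeasure_closedBall n
  have hV0 : volume (Metric.ball (0 : EuclideanSpace ℝ (Fin (n + 1))) 1) ≠ 0 :=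
    (Metric.measure_ball_pos _ _ one_pos).ne'
  have hVt : volume (Metric.ball (0 : EuclideanSpace ℝ (Fin (n + 1))) 1) ≠ ∞ :=
    measure_ball_lt_top.ne
  have hK : ∀ k : ℝ, ENNReal.ofReal k *
      volume (Metric.ball (0 : EuclideanSpace ℝ (Fin (n + 1))) 1) ≠ ∞ :=
    fun k => ENNReal.mul_ne_top ENNReal.ofReal_ne_top hVt
  have hann : ∀ t : ℝ, 0 < t → t ≤ 1 / 2 →
      ∀ x ∈ Metric.ball (0 : EuclideanSpace ℝ (Fin (n + 1))) (1 * t),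
      c * ENNReal.ofReal t ^ (0 : ℝ) ≤
        sphereMeasure (n + 1) {w | x - w ∈ annulus (n + 1) t} := by
    intro t ht ht2 x hx
    refine le_sphereMeasure_of_forall_norm_eq_one hc t fun w hw => ?_
    rw [mem_ball_zero_iff] at hx
    rw [mem_annulus]
    have h1 := norm_sub_norm_le w x
    rw [norm_sub_rev] at h1
    constructor <;> linarith [norm_sub_le x w]
  have := H.scaling (s₁ := annulus (n + 1)) (s₂ := annulus (n + 1))
    (s₃ := fun t => Metric.ball 0 (1 * t))
    (measurableSet_annulus _) (measurableSet_annulus _) (fun _ => measurableSet_ball)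
    hc0 hc0 (c₃ := ENNReal.ofReal (1 ^ (n + 1)) *
      volume (Metric.ball (0 : EuclideanSpace ℝ (Fin (n + 1))) 1))
    (by simpa using hV0) (hK _) (hK _) (hK _) 0 0 (n + 1 : ℕ) 1 1
    hann hann
    (fun t ht _ => (volume_ball_mul one_pos ht).ge)
    (fun t ht ht2 => volume_annulus_le ht ht2)
    (fun t ht ht2 => volume_annulus_le ht ht2)
    (fun t ht _ => (volume_ball_mul one_pos ht).le)
  push_cast at this
  linarith

/-- Testing on two small balls and an annulus. -/
lemma ChainBound.ball_ball_annulus {n : ℕ} {p₁ p₂ p₃ : ℝ≥0∞} {C : ℝ}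
    (H : ChainBound (n + 1) p₁ p₂ p₃ C) :
    (n + 1) * (p₁⁻¹).toReal + (n + 1) * (p₂⁻¹).toReal + (p₃⁻¹).toReal ≤ 2 * n + 1 := by
  obtain ⟨c, hc0, hc⟩ := exists_le_sphereMeasure_closedBall n
  have hV0 : volume (Metric.ball (0 : EuclideanSpace ℝ (Fin (n + 1))) 1) ≠ 0 :=
    (Metric.measure_ball_pos _ _ one_pos).ne'
  have hVt : volume (Metric.ball (0 : EuclideanSpace ℝ (Fin (n + 1))) 1) ≠ ∞ :=
    measure_ball_lt_top.ne
  have hK : ∀ k : ℝ, ENNReal.ofReal k *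
      volume (Metric.ball (0 : EuclideanSpace ℝ (Fin (n + 1))) 1) ≠ ∞ :=
    fun k => ENNReal.mul_ne_top ENNReal.ofReal_ne_top hVt
  have := H.scaling (s₁ := fun t => Metric.ball 0 (3 * t)) (s₂ := fun t => Metric.ball 0 (3 * t))
    (s₃ := annulus (n + 1))
    (fun _ => measurableSet_ball) (fun _ => measurableSet_ball) (measurableSet_annulus _)
    hc0 hc0 hV0 (hK _) (hK _) (hK _) n n 1 (n + 1 : ℕ) (n + 1 : ℕ)
    (fun t ht ht2 _ hx => le_sphereMeasure_of_mem_annulus hc ht ht2 hx)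
    (fun t ht ht2 _ hx => le_sphereMeasure_of_mem_annulus hc ht ht2 hx)
    (fun t ht ht2 => le_volume_annulus n.succ_ne_zero ht ht2)
    (fun t ht _ => (volume_ball_mul three_pos ht).le)
    (fun t ht _ => (volume_ball_mul three_pos ht).le)
    (fun t ht ht2 => volume_annulus_le ht ht2)
  push_cast at this
  linarith

/-- Testing on a small ball, a fixed ball and an annulus. -/
lemma ChainBound.ball_annulus {n : ℕ} {p₁ p₂ p₃ : ℝ≥0∞} {C : ℝ}
    (H : ChainBound (n + 1) p₁ p₂ p₃ C) :
    (n + 1) * (p₁⁻¹).toReal + (p₃⁻¹).toReal ≤ n + 1 := by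
  obtain ⟨c, hc0, hc⟩ := exists_le_sphereMeasure_closedBall n
  have hV0 : volume (Metric.ball (0 : EuclideanSpace ℝ (Fin (n + 1))) 1) ≠ 0 :=
    (Metric.measure_ball_pos _ _ one_pos).ne'
  have hVt : volume (Metric.ball (0 : EuclideanSpace ℝ (Fin (n + 1))) 1) ≠ ∞ :=
    measure_ball_lt_top.ne
  have hK : ∀ k : ℝ, ENNReal.ofReal k *
      volume (Metric.ball (0 : EuclideanSpace ℝ (Fin (n + 1))) 1) ≠ ∞ :=
    fun k => ENNReal.mul_ne_top ENNReal.ofReal_ne_top hVt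
  have hbig : ∀ t : ℝ, 0 < t → t ≤ 1 / 2 → ∀ x ∈ annulus (n + 1) t,
      c * ENNReal.ofReal t ^ (0 : ℝ) ≤
        sphereMeasure (n + 1) {w | x - w ∈ Metric.ball 0 3} := by
    intro t ht ht2 x hx
    refine le_sphereMeasure_of_forall_norm_eq_one hc t fun w hw => ?_
    rw [mem_annulus] at hx
    rw [mem_ball_zero_iff]
    linarith [norm_sub_le x w, hx.1]
  have := H.scaling (s₁ := fun t => Metric.ball 0 (3 * t)) (s₂ := fun _ => Metric.ball 0 3)
    (s₃ := annulus (n + 1))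
    (fun _ => measurableSet_ball) (fun _ => measurableSet_ball) (measurableSet_annulus _)
    hc0 hc0 hV0 (hK _)
    (K₂ := volume (Metric.ball (0 : EuclideanSpace ℝ (Fin (n + 1))) 3)) measure_ball_lt_top.ne
    (hK _) n 0 1 (n + 1 : ℕ) 0
    (fun t ht ht2 _ hx => le_sphereMeasure_of_mem_annulus hc ht ht2 hx)
    hbig
    (fun t ht ht2 => le_volume_annulus n.succ_ne_zero ht ht2)
    (fun t ht _ => (volume_ball_mul three_pos ht).le)
    (fun t _ _ => by simp)
    (fun t ht ht2 => volume_annulus_le ht ht2)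
  push_cast at this
  linarith

/-- **Necessary conditions for the chain form.** If
`∫ Af(x) Ag(x) h(x) dx ≤ C ‖f‖_{p₁} ‖g‖_{p₂} ‖h‖_{p₃}` for all nonnegative measurable
`f, g, h` on `ℝ^d`, then the exponents satisfy the five stated linear constraints. -/
theorem chain_form_necessary_conditions (d : ℕ) (hd : 2 ≤ d)
    (p₁ p₂ p₃ : ℝ≥0∞) (hp₁ : 1 ≤ p₁) (hp₂ : 1 ≤ p₂) (hp₃ : 1 ≤ p₃)
    (C : ℝ)
    (hbound : ∀ f g h : EuclideanSpace ℝ (Fin d) → ℝ≥0,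
      Measurable f → Measurable g → Measurable h →
      (∫⁻ x, sphereAvg d f x * sphereAvg d g x * (h x : ℝ≥0∞)) ≤
        ENNReal.ofReal C * (nnLpNorm' p₁ f * (nnLpNorm' p₂ g * nnLpNorm' p₃ h))) :
    1 ≤ p₁⁻¹ + p₂⁻¹ + p₃⁻¹ ∧
    p₁⁻¹ + p₂⁻¹ + d * p₃⁻¹ ≤ d ∧
    d * p₁⁻¹ + d * p₂⁻¹ + p₃⁻¹ ≤ 2 * d - 1 ∧
    d * p₁⁻¹ + p₃⁻¹ ≤ d ∧
    d * p₂⁻¹ + p₃⁻¹ ≤ d := by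
  obtain ⟨n, rfl⟩ : ∃ n, d = n + 1 := ⟨d - 1, by omega⟩
  have H : ChainBound (n + 1) p₁ p₂ p₃ C := hbound
  have e : ∀ p : ℝ≥0∞, 1 ≤ p → ∃ a : ℝ≥0, p⁻¹ = a := fun p hp =>
    ⟨(p⁻¹).toNNReal, (ENNReal.coe_toNNReal (ENNReal.inv_ne_top.2 (by positivity))).symm⟩
  have h1 := H.one_le
  have h2 := H.annulus_annulus_ball
  have h3 := H.ball_ball_annulus
  have h4 := H.ball_annulus
  have h5 := H.symm.ball_annulus
  obtain ⟨a, ha⟩ := e p₁ hp₁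
  obtain ⟨b, hb⟩ := e p₂ hp₂
  obtain ⟨c, hc⟩ := e p₃ hp₃
  rw [ha, hb, hc, ENNReal.coe_toReal, ENNReal.coe_toReal, ENNReal.coe_toReal] at h1 h2 h3
  rw [ha, hc, ENNReal.coe_toReal, ENNReal.coe_toReal] at h4
  rw [hb, hc, ENNReal.coe_toReal, ENNReal.coe_toReal] at h5
  have hd' : (2 * ((n + 1 : ℕ) : ℝ≥0∞) - 1) = ((2 * n + 1 : ℝ≥0) : ℝ≥0∞) := by
    refine ENNReal.sub_eq_of_eq_add ENNReal.one_ne_top ?_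
    push_cast
    ring
  rw [hd', ha, hb, hc]
  push_cast
  refine ⟨?_, ?_, ?_, ?_, ?_⟩
  · exact_mod_cast h1
  · exact_mod_cast h2
  · exact_mod_cast h3
  · exact_mod_cast h4
  · exact_mod_cast h5
end
end
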